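/- arXiv:1903.03309 — 15 statements merged into one kernel-verified Lean document; each statement's English description precedes it below -/
import Mathlib

section
/- Every Bernoulli congestion game is an exact potential game: defining the expected Rosenthal potential Φ(s) = Σ_{I ⊆ N} p(I) · Σ_{e ∈ E} Σ_{k=1}^{N_e(s,I)} c_e(k), for every strategy profile s, every player i ∈ N, and every s'_i ∈ S_i, the unilaterally deviated profile s' = (s'_i, s_{-i}) satisfies C_i(s') − C_i(s) = Φ(s') − Φ(s). -/
open Finset

/-- Probability that the set of active players is exactly `I`:
`p(I) = ∏_{j∈I} p_j · ∏_{j∉I} (1 − p_j)`. -/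
noncomputable def probOf {ι : Type*} [Fintype ι] [DecidableEq ι]
    (p : ι → ℝ) (I : Finset ι) : ℝ :=
  (∏ j ∈ I, p j) * ∏ j ∈ Iᶜ, (1 - p j)

/-- Load of resource `e` under the profile `s` when the active set is `I`:
`N_e(s,I) = |{ j ∈ I : e ∈ s_j }|`. -/
def load {ι E : Type*} [DecidableEq E]
    (s : ι → Finset E) (I : Finset ι) (e : E) : ℕ :=
  (I.filter fun j => e ∈ s j).card

/-- Expected cost of player `i`:
`C_i(s) = Σ_{e ∈ s_i} Σ_{I ⊆ N, i ∈ I} p(I) · c_e(N_e(s,I))`. -/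
noncomputable def playerCost {ι E : Type*} [Fintype ι] [DecidableEq ι] [DecidableEq E]
    (p : ι → ℝ) (c : E → ℕ → ℝ) (s : ι → Finset E) (i : ι) : ℝ :=
  ∑ e ∈ s i, ∑ I ∈ (Finset.univ : Finset (Finset ι)).filter (fun I => i ∈ I),
    probOf p I * c e (load s I e)

/-- The expected Rosenthal potential:
`Φ(s) = Σ_{I ⊆ N} p(I) · Σ_{e ∈ E} Σ_{k=1}^{N_e(s,I)} c_e(k)`. -/
noncomputable def expPotential {ι E : Type*} [Fintype ι] [DecidableEq ι]
    [Fintype E] [DecidableEq E]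
    (p : ι → ℝ) (c : E → ℕ → ℝ) (s : ι → Finset E) : ℝ :=
  ∑ I : Finset ι, probOf p I * ∑ e : E, ∑ k ∈ Finset.Icc 1 (load s I e), c e k

/-- The load of `e` splits into the contribution of player `i` and that of the other players. -/
lemma load_eq_load_erase_add {ι E : Type*} [DecidableEq ι] [DecidableEq E]
    (s : ι → Finset E) (I : Finset ι) (e : E) (i : ι) :
    load s I e = load s (I.erase i) e + if i ∈ I ∧ e ∈ s i then 1 else 0 := by
  unfold load
  rw [Finset.filter_erase]
  split_ifs with h
  · exact (Finset.card_erase_add_one (Finset.mem_filter.mpr h)).symm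
  · rw [Finset.erase_eq_of_notMem (by simpa using h), add_zero]

/-- The load produced by the players other than `i` does not depend on the strategy of `i`. -/
lemma load_update_erase {ι E : Type*} [DecidableEq ι] [DecidableEq E]
    (s : ι → Finset E) (I : Finset ι) (e : E) (i : ι) (t : Finset E) :
    load (Function.update s i t) (I.erase i) e = load s (I.erase i) e := by
  unfold load
  congr 1
  refine Finset.filter_congr fun j hj => ?_
  rw [Function.update_of_ne (Finset.ne_of_mem_erase hj)]

/-- Rosenthal's sum at `e` is the sum without player `i` plus the cost incurred by `i` at `e`. -/
lemma sum_Icc_load {ι E : Type*} [DecidableEq ι] [DecidableEq E]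
    (c : E → ℕ → ℝ) (s : ι → Finset E) (I : Finset ι) (e : E) (i : ι) :
    ∑ k ∈ Finset.Icc 1 (load s I e), c e k
      = (if i ∈ I ∧ e ∈ s i then c e (load s I e) else 0)
        + ∑ k ∈ Finset.Icc 1 (load s (I.erase i) e), c e k := by
  rw [load_eq_load_erase_add s I e i]
  split_ifs with h
  · rw [Finset.sum_Icc_succ_top (by omega), add_comm]
  · simp

lemma playerCost_eq_sum_ite {ι E : Type*} [Fintype ι] [DecidableEq ι]
    [Fintype E] [DecidableEq E]
    (p : ι → ℝ) (c : E → ℕ → ℝ) (s : ι → Finset E) (i : ι) :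
    playerCost p c s i = ∑ I : Finset ι, probOf p I *
      ∑ e : E, if i ∈ I ∧ e ∈ s i then c e (load s I e) else 0 := by
  unfold playerCost
  rw [Finset.sum_comm, Finset.sum_filter]
  refine Finset.sum_congr rfl fun I _ => ?_
  by_cases h : i ∈ I <;> simp [h, Finset.mul_sum]

/-- The potential is the cost of player `i` plus the potential of the game without `i`. -/
lemma expPotential_eq_playerCost_add {ι E : Type*} [Fintype ι] [DecidableEq ι]
    [Fintype E] [DecidableEq E]
    (p : ι → ℝ) (c : E → ℕ → ℝ) (s : ι → Finset E) (i : ι) :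
    expPotential p c s = playerCost p c s i + ∑ I : Finset ι, probOf p I *
      ∑ e : E, ∑ k ∈ Finset.Icc 1 (load s (I.erase i) e), c e k := by
  rw [playerCost_eq_sum_ite, expPotential, ← Finset.sum_add_distrib]
  refine Finset.sum_congr rfl fun I _ => ?_
  rw [← mul_add, ← Finset.sum_add_distrib]
  exact congrArg _ (Finset.sum_congr rfl fun e _ => sum_Icc_load c s I e i)

/-- Every Bernoulli congestion game is an exact potential game, with the expected
Rosenthal potential: for every profile `s`, every player `i`, and every deviation
`s'_i ∈ S_i`, we have `C_i(s'_i, s_{-i}) − C_i(s) = Φ(s'_i, s_{-i}) − Φ(s)`. -/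
theorem bernoulli_congestion_exact_potential
    {ι E : Type*} [Fintype ι] [DecidableEq ι] [Fintype E] [DecidableEq E]
    (S : ι → Finset (Finset E)) (c : E → ℕ → ℝ) (p : ι → ℝ)
    (hS : ∀ i, (S i).Nonempty)
    (hc : ∀ e k, 0 ≤ c e k)
    (hp : ∀ i, p i ∈ Set.Icc (0 : ℝ) 1)
    (s : ι → Finset E) (hs : ∀ i, s i ∈ S i)
    (i : ι) (si' : Finset E) (hsi' : si' ∈ S i) :
    playerCost p c (Function.update s i si') i - playerCost p c s i
      = expPotential p c (Function.update s i si') - expPotential p c s := by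
  rw [expPotential_eq_playerCost_add p c s i,
    expPotential_eq_playerCost_add p c (Function.update s i si') i]
  simp only [load_update_erase]
  ring
end

section
/- If a finite cost game is (λ,μ)-smooth, i.e. λ ≥ 0, μ ∈ [0,1), and Σ_{i∈N} C_i(s'_i, s_{-i}) ≤ λ·C(s') + μ·C(s) for all strategy profiles s, s', then for every pure Nash equilibrium s* (a profile with C_i(s*) ≤ C_i(s_i, s*_{-i}) for all i and all s_i ∈ S_i) and every strategy profile s' one has C(s*) ≤ (λ/(1−μ))·C(s'). -/
/-- If a finite cost game is `(λ,μ)`-smooth, then the social cost of any pure Nash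
equilibrium `s*` is at most `λ/(1−μ)` times the social cost of any profile `s'`. -/
theorem smooth_implies_poa_bound
    {ι : Type*} [Fintype ι] [DecidableEq ι]
    (S : ι → Type*) [∀ i, Fintype (S i)] [∀ i, Nonempty (S i)]
    (C : ι → (∀ i, S i) → ℝ) (hC : ∀ i s, 0 ≤ C i s)
    (lam mu : ℝ) (hlam : 0 ≤ lam) (hmu0 : 0 ≤ mu) (hmu1 : mu < 1)
    (hsmooth : ∀ s s' : ∀ i, S i,
      ∑ i, C i (Function.update s i (s' i))
        ≤ lam * (∑ i, C i s') + mu * (∑ i, C i s))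
    (sstar : ∀ i, S i)
    (heq : ∀ i, ∀ si : S i, C i sstar ≤ C i (Function.update sstar i si))
    (s' : ∀ i, S i) :
    ∑ i, C i sstar ≤ (lam / (1 - mu)) * ∑ i, C i s' := by
  have hdev : ∑ i, C i sstar ≤ ∑ i, C i (Function.update sstar i (s' i)) :=
    Finset.sum_le_sum fun i _ => heq i (s' i)
  rw [div_mul_eq_mul_div, le_div_iff₀ (sub_pos.mpr hmu1)]
  linarith [hsmooth sstar s']
end

section
/- Let p ∈ (0,1], λ ≥ 0 and μ ∈ [0,1). Then the smoothness condition k·c^p(m+1) ≤ λ·k·c^p(k) + μ·m·c^p(m) holds for all integers k ≥ 1 and m ≥ 0 (with the convention that the term m·c^p(m) equals 0 when m = 0) and for every affine cost function c(x) = a·x + b with a, b ≥ 0, if and only if k(1 + m·p) ≤ λ·k(1 − p + p·k) + μ·m(1 − p + p·m) for all integers k, m ≥ 0. -/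
/-- For affine costs `c(x) = a·x + b` with `a, b ≥ 0` and `p ∈ (0,1]`, the
Bernoulli-adjusted cost is `c^p(x) = p·(a·(1 − p + p·x) + b)`.  The smoothness
condition `k·c^p(m+1) ≤ λ·k·c^p(k) + μ·m·c^p(m)` holds for all integers `k ≥ 1`,
`m ≥ 0` and all such affine costs, if and only if
`k(1 + m·p) ≤ λ·k(1 − p + p·k) + μ·m(1 − p + p·m)` for all integers `k, m ≥ 0`. -/
theorem affine_smoothness_iff (p lam mu : ℝ) (hp0 : 0 < p) (hp1 : p ≤ 1)
    (hlam : 0 ≤ lam) (hmu0 : 0 ≤ mu) (hmu1 : mu < 1) :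
    (∀ a b : ℝ, 0 ≤ a → 0 ≤ b → ∀ k m : ℕ, 1 ≤ k →
        (k : ℝ) * (p * (a * (1 - p + p * ((m : ℝ) + 1)) + b))
          ≤ lam * (k : ℝ) * (p * (a * (1 - p + p * (k : ℝ)) + b))
            + mu * (m : ℝ) * (p * (a * (1 - p + p * (m : ℝ)) + b)))
    ↔ (∀ k m : ℕ,
        (k : ℝ) * (1 + (m : ℝ) * p)
          ≤ lam * (k : ℝ) * (1 - p + p * (k : ℝ))
            + mu * (m : ℝ) * (1 - p + p * (m : ℝ))) := by
  constructor
  · intro h k m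
    rcases Nat.eq_zero_or_pos k with rfl | hk
    · have h1 : 0 ≤ 1 - p + p * (m : ℝ) :=
        add_nonneg (sub_nonneg.mpr hp1) (by positivity)
      have h2 : 0 ≤ mu * (m : ℝ) * (1 - p + p * (m : ℝ)) := by positivity
      simpa using h2
    · refine le_of_mul_le_mul_left ?_ hp0
      linarith [h 1 0 zero_le_one le_rfl k m hk]
  · intro h a b ha hb k m _
    have hlam1 : 1 ≤ lam := by simpa using h 1 0
    have hconst : (k : ℝ) ≤ lam * k + mu * m :=
      (le_mul_of_one_le_left k.cast_nonneg hlam1).trans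
        (le_add_of_nonneg_right (by positivity))
    linarith [mul_le_mul_of_nonneg_left (h k m) (mul_nonneg hp0.le ha),
      mul_le_mul_of_nonneg_left hconst (mul_nonneg hp0.le hb)]
end

section
/- For every p with 0 < p ≤ 1/4 and all integers k, m ≥ 0, one has k(1 + m·p) ≤ 1·k(1 − p + p·k) + (1/4)·m(1 − p + p·m); that is, the class of Bernoulli congestion games with affine costs and homogeneous participation probability p ≤ 1/4 is (λ,μ)-smooth with (λ,μ) = (1, 1/4). -/
/-- For every `p` with `0 < p ≤ 1/4` and all integers `k, m ≥ 0`,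
`k(1 + m·p) ≤ 1·k(1 − p + p·k) + (1/4)·m(1 − p + p·m)`; i.e. Bernoulli congestion
games with affine costs and homogeneous participation probability `p ≤ 1/4` are
`(1, 1/4)`-smooth. -/
theorem smooth_low (p : ℝ) (hp0 : 0 < p) (hp1 : p ≤ 1 / 4) :
    ∀ k m : ℕ,
      (k : ℝ) * (1 + (m : ℝ) * p)
        ≤ 1 * (k : ℝ) * (1 - p + p * (k : ℝ))
          + (1 / 4) * (m : ℝ) * (1 - p + p * (m : ℝ)) := by
  intro k m
  -- With `d = 2k - m`, the case `1 - p = 3p` reduces to `0 ≤ d² - 3d + 2k`.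
  have hint : (0 : ℤ) ≤ (2 * k - m) ^ 2 - 3 * (2 * k - m) + 2 * k := by
    rcases Nat.eq_zero_or_pos k with rfl | hk
    · push_cast
      nlinarith [Int.natCast_nonneg m]
    · have hk' : (1 : ℤ) ≤ k := by exact_mod_cast hk
      rcases le_or_gt (2 * k - m : ℤ) 1 with h | h
      · nlinarith
      · nlinarith [Int.add_one_le_iff.mpr h]
  have hreal : (0 : ℝ) ≤ (2 * k - m) ^ 2 - 3 * (2 * k - m) + 2 * k := by
    exact_mod_cast hint
  have hm : (0 : ℝ) ≤ m * (1 - 4 * p) := mul_nonneg m.cast_nonneg (by linarith)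
  nlinarith [mul_nonneg hp0.le hreal]
end

section
/- For every p with 1/4 ≤ p ≤ 1 and 8p³ + 4p² ≤ 1, setting λ = (1 + p + √(p(2+p)))/2 and μ = (1 + p − √(p(2+p)))/2, one has μ ∈ [0,1) and k(1 + m·p) ≤ λ·k(1 − p + p·k) + μ·m(1 − p + p·m) for all integers k, m ≥ 0; that is, the class of Bernoulli congestion games with affine costs and homogeneous participation probability p in this range is (λ,μ)-smooth with these parameters. -/
/-- The smoothness inequality for `k = 1`, with `λ = 1 + p - μ`. -/
lemma smooth_of_one {p μ : ℝ} (hp : 0 ≤ p) (hμ : 0 ≤ μ) (hμp : μ ≤ p)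
    (h : p ≤ μ * (1 + 2 * p)) (m : ℕ) :
    1 + (m : ℝ) * p ≤ (1 + p - μ) + μ * m * (1 - p + p * m) := by
  rcases m with _ | _ | n
  · simp only [Nat.cast_zero]
    linarith
  · norm_num
  · have hn : (0 : ℝ) ≤ n := n.cast_nonneg
    have hbracket : 0 ≤ μ * (1 + p * ((n : ℝ) + 2)) - p := by
      nlinarith [mul_nonneg (mul_nonneg hμ hp) hn]
    push_cast
    nlinarith [mul_nonneg (by linarith : (0 : ℝ) ≤ n + 1) hbracket]

/-- The smoothness inequality for real `k ≥ 2` and arbitrary real `m`: its discriminant as a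
quadratic in `m` is nonpositive. -/
lemma smooth_of_two_le {p l μ k m : ℝ} (hp : 0 < p) (hμ : 0 < μ) (hlμ : 4 * (l * μ) = 1)
    (h : μ ^ 2 * (1 - p) ^ 2 ≤ 2 * (p * ((1 - p) * (1 + 2 * μ) - 4 * μ))) (hk : 2 ≤ k) :
    k * (1 + m * p) ≤ l * k * (1 - p + p * k) + μ * m * (1 - p + p * m) := by
  set b := p * ((1 - p) * (1 + 2 * μ) - 4 * μ) with hb
  have hb0 : 0 ≤ b := by nlinarith [sq_nonneg (μ * (1 - p))]
  have hdisc : μ ^ 2 * (1 - p) ^ 2 ≤ k * b := by nlinarith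
  have hsq : 4 * (p * μ) *
      (l * k * (1 - p + p * k) + μ * m * (1 - p + p * m) - k * (1 + m * p)) =
      (2 * p * μ * m - (k * p - μ * (1 - p))) ^ 2 + (k * b - μ ^ 2 * (1 - p) ^ 2) := by
    rw [hb]
    linear_combination (p * k * (1 - p + p * k)) * hlμ
  have hpos : 0 < 4 * (p * μ) := by positivity
  have := nonneg_of_mul_nonneg_right
    (hsq ▸ add_nonneg (sq_nonneg _) (sub_nonneg.mpr hdisc)) hpos
  linarith

/-- The discriminant condition for `k ≥ 2`, with a linear function of `p` in place of `μ`. -/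
lemma chord_discriminant_le {p : ℝ} (hp0 : 1 / 4 ≤ p) (hp1 : p ≤ 189 / 500) :
    (1 / 4 - 27 / 100 * (p - 1 / 4)) ^ 2 * (1 - p) ^ 2 ≤
      2 * (p * ((1 - p) * (1 + 2 * (1 / 4 - 27 / 100 * (p - 1 / 4)))
        - 4 * (1 / 4 - 27 / 100 * (p - 1 / 4)))) := by
  obtain ⟨q, rfl⟩ : ∃ q, p = 1 / 4 + q := ⟨p - 1 / 4, by ring⟩
  have hq0 : 0 ≤ q := by linarith
  have hq1 : q ≤ 16 / 125 := by linarith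
  have hqq : q ^ 2 ≤ 16 / 125 * q := by nlinarith
  have hline : (1 / 4 - 27 / 100 * q) * (3 / 4 - q) ≤ 3 / 16 - 417 / 1000 * q := by
    linarith
  have hpos : 0 ≤ (1 / 4 - 27 / 100 * q) * (3 / 4 - q) :=
    mul_nonneg (by linarith) (by linarith)
  have hsq := pow_le_pow_left₀ hpos hline 2
  have hcube := pow_nonneg hq0 3
  linarith

/-- For every `p` with `1/4 ≤ p ≤ 1` and `8p³ + 4p² ≤ 1`, with
`λ = (1 + p + √(p(2+p)))/2` and `μ = (1 + p − √(p(2+p)))/2`, one has `μ ∈ [0,1)`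
and the smoothness inequality
`k(1 + m·p) ≤ λ·k(1 − p + p·k) + μ·m(1 − p + p·m)` for all integers `k, m ≥ 0`. -/
theorem smooth_mid (p : ℝ) (hp0 : 1 / 4 ≤ p) (hp1 : p ≤ 1)
    (hcube : 8 * p ^ 3 + 4 * p ^ 2 ≤ 1) :
    (0 ≤ (1 + p - Real.sqrt (p * (2 + p))) / 2
        ∧ (1 + p - Real.sqrt (p * (2 + p))) / 2 < 1)
    ∧ ∀ k m : ℕ,
        (k : ℝ) * (1 + (m : ℝ) * p)
          ≤ ((1 + p + Real.sqrt (p * (2 + p))) / 2) * (k : ℝ) * (1 - p + p * (k : ℝ))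
            + ((1 + p - Real.sqrt (p * (2 + p))) / 2) * (m : ℝ) * (1 - p + p * (m : ℝ)) := by
  have hp : 0 < p := by linarith
  have hp378 : p ≤ 189 / 500 := by
    by_contra! hlt
    nlinarith [pow_lt_pow_left₀ hlt (by norm_num) two_ne_zero,
      pow_lt_pow_left₀ hlt (by norm_num) three_ne_zero]
  set s := Real.sqrt (p * (2 + p)) with hs
  have hs0 : 0 ≤ s := Real.sqrt_nonneg _
  have hs2 : s ^ 2 = p * (2 + p) := Real.sq_sqrt (by positivity)
  set μ := (1 + p - s) / 2 with hμdef
  have hl : (1 + p + s) / 2 = 1 + p - μ := by rw [hμdef]; ring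
  have hlμ : 4 * ((1 + p - μ) * μ) = 1 := by rw [hμdef]; linear_combination -hs2
  have hμ : 0 < μ := by
    have : s < 1 + p := by nlinarith
    rw [hμdef]; linarith
  -- the chord of the convex function `μ` of `p` over `[1/4, 189/500]`, slightly raised
  have hchord : μ ≤ 1 / 4 - 27 / 100 * (p - 1 / 4) := by
    have : 1 + p - 2 * (1 / 4 - 27 / 100 * (p - 1 / 4)) ≤ s :=
      Real.le_sqrt_of_sq_le (by nlinarith)
    rw [hμdef]; linarith
  have htwo : p ≤ μ * (1 + 2 * p) := by
    have : s * (1 + 2 * p) ≤ 1 + p + 2 * p ^ 2 := by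
      refine (abs_le_of_sq_le_sq' ?_ (by positivity)).2
      rw [mul_pow, hs2]
      nlinarith
    rw [hμdef]; linarith
  have hdisc : μ ^ 2 * (1 - p) ^ 2 ≤ 2 * (p * ((1 - p) * (1 + 2 * μ) - 4 * μ)) := by
    set c := 1 / 4 - 27 / 100 * (p - 1 / 4)
    have hsq : μ ^ 2 * (1 - p) ^ 2 ≤ c ^ 2 * (1 - p) ^ 2 := by gcongr
    have hlin : p * ((1 - p) * (1 + 2 * c) - 4 * c) ≤ p * ((1 - p) * (1 + 2 * μ) - 4 * μ) := by
      gcongr p * ?_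
      nlinarith
    exact hsq.trans ((chord_discriminant_le hp0 hp378).trans (by gcongr))
  refine ⟨⟨hμ.le, by linarith⟩, fun k m => ?_⟩
  rw [hl]
  rcases k with _ | _ | n
  · have : 0 ≤ 1 - p + p * (m : ℝ) := by
      have := mul_nonneg hp.le (m.cast_nonneg : (0 : ℝ) ≤ m)
      linarith
    simpa using mul_nonneg (mul_nonneg hμ.le m.cast_nonneg) this
  · simpa using smooth_of_one hp.le hμ.le (by linarith) htwo m
  · refine smooth_of_two_le hp hμ hlμ hdisc ?_
    push_cast
    linarith [(n.cast_nonneg : (0 : ℝ) ≤ n)]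
end

section
/- For every p with p ≤ 1 and 8p³ + 4p² ≥ 1, setting λ = (1 + 2p + 2p²)/(1 + 2p) and μ = p/(1 + 2p), one has μ ∈ [0,1) and k(1 + m·p) ≤ λ·k(1 − p + p·k) + μ·m(1 − p + p·m) for all integers k, m ≥ 0; that is, the class of Bernoulli congestion games with affine costs and homogeneous participation probability p in this range is (λ,μ)-smooth with these parameters. -/
/-- The cubic condition forces `p` to be bounded away from zero. -/
lemma lt_of_one_le_cubic {p : ℝ} (hcube : 1 ≤ 8 * p ^ 3 + 4 * p ^ 2) : 377 / 1000 < p := by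
  by_contra! h
  rcases le_or_gt 0 p with h0 | h0
  · have h2 : p ^ 2 ≤ (377 / 1000) ^ 2 := by gcongr
    have h3 : p ^ 3 ≤ (377 / 1000) ^ 3 := by gcongr
    norm_num at h2 h3
    linarith
  · rcases le_or_gt (1 + 2 * p) 0 with h1 | h1
    · nlinarith [mul_nonneg (sq_nonneg p) (neg_nonneg.mpr h1)]
    · have hsq : 4 * p ^ 2 < 1 := by nlinarith
      nlinarith [mul_nonneg (sq_nonneg p) (neg_nonneg.mpr h0.le)]

/-- The smoothness inequality with denominators and the common factor `p` cleared. -/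
lemma smooth_quadratic_nonneg {p : ℝ} (hp1 : p ≤ 1) (hcube : 1 ≤ 8 * p ^ 3 + 4 * p ^ 2)
    (k m : ℕ) :
    0 ≤ (1 + 2 * p + 2 * p ^ 2) * (k : ℝ) ^ 2 - (1 + 2 * p ^ 2) * k + p * (m : ℝ) ^ 2
      + (1 - p) * m - (1 + 2 * p) * k * m := by
  have hp := lt_of_one_le_cubic hcube
  have hp0 : 0 < p := by linarith
  have hm : (0 : ℝ) ≤ m := m.cast_nonneg
  obtain rfl | rfl | hk : k = 0 ∨ k = 1 ∨ 2 ≤ k := by omega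
  · have := mul_nonneg (sub_nonneg.mpr hp1) hm
    simp only [Nat.cast_zero]
    nlinarith [mul_nonneg hp0.le (sq_nonneg (m : ℝ))]
  · have hint : (0 : ℝ) ≤ ((m : ℝ) - 1) * (m - 2) := by
      obtain rfl | rfl | hm2 : m = 0 ∨ m = 1 ∨ 2 ≤ m := by omega
      · norm_num
      · norm_num
      · have : (2 : ℝ) ≤ m := by exact_mod_cast hm2
        exact mul_nonneg (by linarith) (by linarith)
    have := mul_nonneg hp0.le hint
    simp only [Nat.cast_one]
    linarith
  · have hk2 : (2 : ℝ) ≤ k := by exact_mod_cast hk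
    generalize (k : ℝ) = x at hk2
    generalize (m : ℝ) = y
    have hp2 : 377 / 1000 * p ≤ p ^ 2 := by nlinarith
    have hp3 : 377 / 1000 * p ^ 2 ≤ p ^ 3 := by nlinarith [sq_nonneg p]
    -- the discriminant in `y` is concave in `x`, and nonpositive and decreasing at `x = 2`
    have hdisc_two : 1 + 2 * p - 7 * p ^ 2 - 16 * p ^ 3 ≤ 0 := by nlinarith
    have hslope : (x + 2) * (1 - (8 * p ^ 3 + 4 * p ^ 2)) + (8 * p ^ 3 + 4 * p ^ 2) - 2 + 2 * p
        ≤ 0 := by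
      nlinarith [mul_nonneg (sub_nonneg.mpr hk2) (sub_nonneg.mpr hcube)]
    have hdisc := mul_nonneg (sub_nonneg.mpr hk2) (neg_nonneg.mpr hslope)
    refine nonneg_of_mul_nonneg_right (a := 4 * p) ?_ (by positivity)
    linarith [sq_nonneg (2 * p * y - ((1 + 2 * p) * x - (1 - p)))]

/-- For every `p` with `p ≤ 1` and `8p³ + 4p² ≥ 1`, with
`λ = (1 + 2p + 2p²)/(1 + 2p)` and `μ = p/(1 + 2p)`, one has `μ ∈ [0,1)`
and the smoothness inequality
`k(1 + m·p) ≤ λ·k(1 − p + p·k) + μ·m(1 − p + p·m)` for all integers `k, m ≥ 0`. -/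
theorem smooth_high (p : ℝ) (hp1 : p ≤ 1) (hcube : 1 ≤ 8 * p ^ 3 + 4 * p ^ 2) :
    (0 ≤ p / (1 + 2 * p) ∧ p / (1 + 2 * p) < 1)
    ∧ ∀ k m : ℕ,
        (k : ℝ) * (1 + (m : ℝ) * p)
          ≤ ((1 + 2 * p + 2 * p ^ 2) / (1 + 2 * p)) * (k : ℝ) * (1 - p + p * (k : ℝ))
            + (p / (1 + 2 * p)) * (m : ℝ) * (1 - p + p * (m : ℝ)) := by
  have hp0 : 0 < p := by linarith [lt_of_one_le_cubic hcube]
  have hd : 0 < 1 + 2 * p := by linarith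
  refine ⟨⟨by positivity, by rw [div_lt_one hd]; linarith⟩, fun k m => ?_⟩
  have hquot := div_nonneg
    (mul_nonneg hp0.le (smooth_quadratic_nonneg hp1 hcube k m)) hd.le
  rw [← sub_nonneg]
  refine hquot.trans_eq ?_
  field_simp
  ring
end

section
/- For every p ∈ (0,1] and every y > 0, the limit lim_{k→∞} sup_{m∈ℕ} ψ_p^{k,m}(y) exists, does not depend on p, and equals (y+1)²/(4y); moreover the function y ↦ (y+1)²/(4y) is strictly decreasing on (0,1) and strictly increasing on (1,∞). -/
/-- `ψ_p^{k,m}(y) = y·[(k(1 + p·m) − m(1 − p + p·m)) / (k(1 − p + p·k))]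
                    + (1 + p·m)/(1 − p + p·k)`. -/
noncomputable def psiKM (p : ℝ) (k m : ℕ) (y : ℝ) : ℝ :=
  y * (((k : ℝ) * (1 + p * (m : ℝ)) - (m : ℝ) * (1 - p + p * (m : ℝ)))
        / ((k : ℝ) * (1 - p + p * (k : ℝ))))
    + (1 + p * (m : ℝ)) / (1 - p + p * (k : ℝ))

theorem psiKM_eq_div (p y : ℝ) {k : ℕ} (hk : k ≠ 0) (m : ℕ) :
    psiKM p k m y =
      ((k : ℝ) * (1 + y) - y * (m : ℝ) * (1 - p) + p * ((k : ℝ) * m * (1 + y) - y * (m : ℝ) ^ 2))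
        / ((k : ℝ) * (1 - p + p * (k : ℝ))) := by
  have hk' : (k : ℝ) ≠ 0 := Nat.cast_ne_zero.mpr hk
  unfold psiKM
  field_simp
  ring

theorem psiKM_le {p y : ℝ} (hp0 : 0 < p) (hp1 : p ≤ 1) (hy : 0 < y) {k : ℕ} (hk : 0 < k) (m : ℕ) :
    psiKM p k m y ≤ (y + 1) ^ 2 / (4 * y) + (1 + y) / p / k := by
  have hk' : (0 : ℝ) < k := Nat.cast_pos.mpr hk
  have hpk : 0 < p * (k : ℝ) := by positivity
  have hD : p * (k : ℝ) ≤ 1 - p + p * k := by linarith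
  rw [psiKM_eq_div p y hk.ne' m, div_le_iff₀ (by nlinarith)]
  have hsq : (k : ℝ) * m * (1 + y) - y * (m : ℝ) ^ 2 ≤ (y + 1) ^ 2 / (4 * y) * (k : ℝ) ^ 2 := by
    rw [div_mul_eq_mul_div, le_div_iff₀ (by positivity)]
    nlinarith [sq_nonneg ((k : ℝ) * (1 + y) - 2 * y * m)]
  have hcross : 0 ≤ y * (m : ℝ) * (1 - p) := mul_nonneg (by positivity) (by linarith)
  calc _ ≤ (k : ℝ) * (1 + y) + p * ((y + 1) ^ 2 / (4 * y) * (k : ℝ) ^ 2) := by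
        linarith [mul_le_mul_of_nonneg_left hsq hp0.le]
    _ = ((y + 1) ^ 2 / (4 * y) + (1 + y) / p / k) * (k * (p * k)) := by
        field_simp
        ring
    _ ≤ _ := by gcongr

theorem exists_le_psiKM {p y : ℝ} (hp0 : 0 < p) (hp1 : p ≤ 1) (hy : 0 < y) {k : ℕ} (hk : 0 < k) :
    ∃ m : ℕ, (y + 1) ^ 2 / (4 * y) - ((y + 1) ^ 2 / (4 * y) / p + y) / k ≤ psiKM p k m y := by
  have hk' : (1 : ℝ) ≤ k := Nat.one_le_cast.mpr hk
  have hpk : 0 < p * (k : ℝ) := by positivity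
  have hD : p * (k : ℝ) ≤ 1 - p + p * k := by linarith
  set t : ℝ := (1 + y) / (2 * y) * k with ht
  have ht0 : 0 ≤ t := by positivity
  have hyt : 2 * y * t = (1 + y) * k := by
    rw [ht]
    field_simp
  have hm1 := Nat.floor_le ht0
  have hm2 := Nat.lt_floor_add_one t
  refine ⟨⌊t⌋₊, ?_⟩
  set m : ℝ := (⌊t⌋₊ : ℝ)
  rw [psiKM_eq_div p y hk.ne' _, le_div_iff₀ (by nlinarith)]
  have hmax : (y + 1) ^ 2 / (4 * y) * (k : ℝ) ^ 2 = y * t ^ 2 := by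
    rw [ht]
    field_simp
    ring
  have hsq : y * t ^ 2 - y ≤ (k : ℝ) * m * (1 + y) - y * m ^ 2 := by
    have hround : y * (t - m) ^ 2 ≤ y * 1 := by
      gcongr
      nlinarith
    have hlin : (k : ℝ) * m * (1 + y) = 2 * y * t * m := by rw [hyt]; ring
    rw [hlin]
    linarith [hround]
  have hcross : y * m * (1 - p) ≤ (k : ℝ) * (1 + y) := by
    have hym : y * m ≤ y * t := by gcongr
    have hym0 : 0 ≤ y * m := by positivity
    nlinarith
  set L := (y + 1) ^ 2 / (4 * y)
  have hL : 0 ≤ L := by positivity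
  have hmain : p * (L * (k : ℝ) ^ 2 - y) ≤
      (k : ℝ) * (1 + y) - y * m * (1 - p) + p * ((k : ℝ) * m * (1 + y) - y * m ^ 2) := by
    rw [hmax]
    linarith [mul_le_mul_of_nonneg_left hsq hp0.le]
  refine le_trans ?_ hmain
  have hexp : (L - (L / p + y) / k) * (k * (1 - p + p * k)) =
      L * k * (1 - p + p * k) - L / p * (1 - p + p * k) - y * (1 - p + p * k) := by
    field_simp
    ring
  have hLp : L / p * (p * k) ≤ L / p * (1 - p + p * k) := by gcongr
  have hLp' : L / p * (p * k) = L * k := by field_simp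
  have hpLk : 0 ≤ L * k * p := by positivity
  have hyD : y * p ≤ y * (1 - p + p * k) := by
    gcongr
    nlinarith
  rw [hexp]
  linarith

theorem tendsto_iSup_psiKM {p y : ℝ} (hp0 : 0 < p) (hp1 : p ≤ 1) (hy : 0 < y) :
    Filter.Tendsto (fun k : ℕ => ⨆ m : ℕ, psiKM p k m y) Filter.atTop
      (nhds ((y + 1) ^ 2 / (4 * y))) := by
  have hlower := (tendsto_const_nhds (x := (y + 1) ^ 2 / (4 * y))).sub
    (tendsto_const_div_atTop_nhds_zero_nat ((y + 1) ^ 2 / (4 * y) / p + y))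
  have hupper := (tendsto_const_nhds (x := (y + 1) ^ 2 / (4 * y))).add
    (tendsto_const_div_atTop_nhds_zero_nat ((1 + y) / p))
  rw [sub_zero] at hlower
  rw [add_zero] at hupper
  refine tendsto_of_tendsto_of_tendsto_of_le_of_le' hlower hupper ?_ ?_
  · filter_upwards [Filter.eventually_gt_atTop 0] with k hk
    obtain ⟨m, hm⟩ := exists_le_psiKM hp0 hp1 hy hk
    refine hm.trans (le_ciSup (f := fun m => psiKM p k m y)
      ⟨(y + 1) ^ 2 / (4 * y) + (1 + y) / p / k, ?_⟩ m)
    rintro _ ⟨n, rfl⟩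
    exact psiKM_le hp0 hp1 hy hk n
  · filter_upwards [Filter.eventually_gt_atTop 0] with k hk
    exact ciSup_le fun m => psiKM_le hp0 hp1 hy hk m

theorem strictAntiOn_add_one_sq_div :
    StrictAntiOn (fun y : ℝ => (y + 1) ^ 2 / (4 * y)) (Set.Ioo 0 1) := by
  rintro a ⟨ha0, ha1⟩ b ⟨hb0, hb1⟩ hab
  have hfactor : 0 < (b - a) * (1 - a * b) := mul_pos (by linarith) (by nlinarith)
  beta_reduce
  rw [div_lt_div_iff₀ (by positivity) (by positivity)]
  linarith

theorem strictMonoOn_add_one_sq_div :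
    StrictMonoOn (fun y : ℝ => (y + 1) ^ 2 / (4 * y)) (Set.Ioi 1) := by
  intro a ha b hb hab
  rw [Set.mem_Ioi] at ha hb
  have hfactor : 0 < (b - a) * (a * b - 1) := mul_pos (by linarith) (by nlinarith)
  beta_reduce
  rw [div_lt_div_iff₀ (by positivity) (by positivity)]
  linarith

/-- For every `p ∈ (0,1]` and every `y > 0`, the limit
`lim_{k→∞} sup_{m∈ℕ} ψ_p^{k,m}(y)` exists and equals `(y+1)²/(4y)`
(in particular it does not depend on `p`); moreover `y ↦ (y+1)²/(4y)` is strictly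
decreasing on `(0,1)` and strictly increasing on `(1,∞)`. -/
theorem psi_limit (p y : ℝ) (hp0 : 0 < p) (hp1 : p ≤ 1) (hy : 0 < y) :
    Filter.Tendsto (fun k : ℕ => ⨆ m : ℕ, psiKM p k m y) Filter.atTop
        (nhds ((y + 1) ^ 2 / (4 * y)))
    ∧ StrictAntiOn (fun y : ℝ => (y + 1) ^ 2 / (4 * y)) (Set.Ioo 0 1)
    ∧ StrictMonoOn (fun y : ℝ => (y + 1) ^ 2 / (4 * y)) (Set.Ioi 1) := by
  exact ⟨tendsto_iSup_psiKM hp0 hp1 hy, strictAntiOn_add_one_sq_div,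
    strictMonoOn_add_one_sq_div⟩
end

section
/- For every p ∈ (0,1] and every y ∈ (0,1): (a) (y+1)²/(4y) = ψ_p^{1,0}(y) if and only if y = 1/3; (b) (y+1)²/(4y) = ψ_p^{1,1}(y) if and only if y = 1/(1 + 2p + 2√(p(2+p))); (c) ψ_p^{1,1}(y) = ψ_p^{1,2}(y) if and only if y = p/(1+p). In particular all three of these values lie in (0,1). -/
/-- For `p ∈ (0,1]` and `y ∈ (0,1)`:
(a) `(y+1)²/(4y) = ψ_p^{1,0}(y)` iff `y = 1/3`;
(b) `(y+1)²/(4y) = ψ_p^{1,1}(y)` iff `y = 1/(1 + 2p + 2√(p(2+p)))`;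
(c) `ψ_p^{1,1}(y) = ψ_p^{1,2}(y)` iff `y = p/(1+p)`.
In particular all three of these values lie in `(0,1)`. -/
theorem psi_crossings (p : ℝ) (hp0 : 0 < p) (hp1 : p ≤ 1) :
    (∀ y ∈ Set.Ioo (0 : ℝ) 1,
      ((y + 1) ^ 2 / (4 * y) = psiKM p 1 0 y ↔ y = 1 / 3)
      ∧ ((y + 1) ^ 2 / (4 * y) = psiKM p 1 1 y
          ↔ y = 1 / (1 + 2 * p + 2 * Real.sqrt (p * (2 + p))))
      ∧ (psiKM p 1 1 y = psiKM p 1 2 y ↔ y = p / (1 + p)))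
    ∧ (1 / 3 : ℝ) ∈ Set.Ioo (0 : ℝ) 1
    ∧ (1 / (1 + 2 * p + 2 * Real.sqrt (p * (2 + p)))) ∈ Set.Ioo (0 : ℝ) 1
    ∧ p / (1 + p) ∈ Set.Ioo (0 : ℝ) 1 := by
  have hs0 : 0 ≤ √(p * (2 + p)) := Real.sqrt_nonneg _
  have hsq : √(p * (2 + p)) ^ 2 = p * (2 + p) := Real.sq_sqrt (by positivity)
  have hps : p < √(p * (2 + p)) := Real.lt_sqrt_of_sq_lt (by nlinarith)
  set s := √(p * (2 + p))
  have hd : 0 < 1 + 2 * p + 2 * s := by positivity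
  refine ⟨fun y ⟨hy0, hy1⟩ => ?_, by norm_num, ⟨by positivity, ?_⟩, ⟨by positivity, ?_⟩⟩
  · have h0 : psiKM p 1 0 y = y + 1 := by simp [psiKM]
    have h1 : psiKM p 1 1 y = p * y + 1 + p := by simp [psiKM]; ring
    have h2 : psiKM p 1 2 y = -y + 1 + 2 * p := by simp [psiKM]; ring
    rw [h0, h1, h2, div_eq_iff (by positivity), div_eq_iff (by positivity),
      eq_div_iff hd.ne', eq_div_iff (by positivity : 1 + p ≠ 0)]
    refine ⟨⟨fun h => ?_, fun h => by rw [h]; norm_num⟩, ⟨fun h => ?_, fun h => ?_⟩,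
      ⟨fun h => by linarith, fun h => by linarith⟩⟩
    · have : y + 1 = 4 * y := mul_left_cancel₀ (by positivity : y + 1 ≠ 0) (by linarith)
      linarith
    · have hpos : 0 < 1 - (1 + 2 * p - 2 * s) * y := by
        nlinarith [mul_pos (sub_pos.2 hps) hy0]
      have hfac : (1 - (1 + 2 * p - 2 * s) * y) * (y * (1 + 2 * p + 2 * s) - 1) = 0 := by
        linear_combination 4 * y ^ 2 * hsq - h
      linarith [(mul_eq_zero.1 hfac).resolve_left hpos.ne']
    · linear_combination 4 * y ^ 2 * hsq - (1 - (1 + 2 * p - 2 * s) * y) * h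
  · rw [div_lt_one hd]
    linarith
  · rw [div_lt_one (by positivity)]
    linarith
end

section
/- For every p ∈ (0,1], the function ψ_p is convex and finite on (0,∞), satisfies ψ_p(y) → ∞ both as y → 0⁺ and as y → ∞, and attains its minimum over (0,∞) at some point y_p > 0. -/
/-- `ψ_p(y) = sup { ψ_p^{k,m}(y) : k, m ∈ ℕ, k ≥ 1 }`. -/
noncomputable def psiSup (p y : ℝ) : ℝ :=
  ⨆ km : ℕ × ℕ, psiKM p (km.1 + 1) km.2 y

theorem psiKM_succ_le {p y : ℝ} (hp0 : 0 < p) (hp1 : p ≤ 1) (hy : 0 < y) (k m : ℕ) :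
    psiKM p (k + 1) m y ≤ (y + 1) + (y + 1) ^ 2 / (4 * y) := by
  unfold psiKM
  push_cast
  have hk : (0 : ℝ) ≤ k := k.cast_nonneg
  have hm : (0 : ℝ) ≤ m := m.cast_nonneg
  generalize (k : ℝ) = k at hk ⊢
  generalize (m : ℝ) = m at hm ⊢
  have hpk : 0 ≤ p * k := by positivity
  have hD : 0 < 1 - p + p * (k + 1) := by linarith
  have hcombine : y * (((k + 1) * (1 + p * m) - m * (1 - p + p * m))
        / ((k + 1) * (1 - p + p * (k + 1)))) + (1 + p * m) / (1 - p + p * (k + 1))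
      = ((y + 1) * (k + 1) * (1 + p * m) - y * m * (1 - p + p * m))
        / ((k + 1) * (1 - p + p * (k + 1))) := by
    field_simp
    ring
  rw [hcombine, div_le_iff₀ (by positivity)]
  have hsq : (y + 1) * (k + 1) * m ≤ y * m ^ 2 + (y + 1) ^ 2 / (4 * y) * (k + 1) ^ 2 := by
    have h : y * m ^ 2 + (y + 1) ^ 2 / (4 * y) * (k + 1) ^ 2 - (y + 1) * (k + 1) * m
        = (2 * y * m - (y + 1) * (k + 1)) ^ 2 / (4 * y) := by
      field_simp
      ring
    have h' : 0 ≤ (2 * y * m - (y + 1) * (k + 1)) ^ 2 / (4 * y) := by positivity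
    linarith
  have hc : 0 ≤ (y + 1) ^ 2 / (4 * y) := by positivity
  generalize (y + 1) ^ 2 / (4 * y) = c at hsq hc ⊢
  have hlin : 0 ≤ y * m * (1 - p) := mul_nonneg (by positivity) (by linarith)
  have hfirst : 0 ≤ (y + 1) * (k + 1) * (p * k) := by positivity
  have hsecond : 0 ≤ c * (k + 1) * (1 - p) := mul_nonneg (by positivity) (by linarith)
  linarith [mul_le_mul_of_nonneg_left hsq hp0.le]

theorem bddAbove_range_psiKM {p y : ℝ} (hp0 : 0 < p) (hp1 : p ≤ 1) (hy : 0 < y) :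
    BddAbove (Set.range fun km : ℕ × ℕ => psiKM p (km.1 + 1) km.2 y) := by
  refine ⟨(y + 1) + (y + 1) ^ 2 / (4 * y), ?_⟩
  rintro _ ⟨km, rfl⟩
  exact psiKM_succ_le hp0 hp1 hy km.1 km.2

theorem psiKM_le_psiSup {p y : ℝ} (hp0 : 0 < p) (hp1 : p ≤ 1) (hy : 0 < y) (k m : ℕ) :
    psiKM p (k + 1) m y ≤ psiSup p y :=
  le_ciSup (bddAbove_range_psiKM hp0 hp1 hy) (k, m)

theorem psiKM_affine (p : ℝ) (k m : ℕ) (x y : ℝ) {a b : ℝ} (hab : a + b = 1) :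
    psiKM p k m (a * x + b * y) = a * psiKM p k m x + b * psiKM p k m y := by
  obtain rfl : b = 1 - a := by linarith
  unfold psiKM
  ring

theorem convexOn_psiSup {p : ℝ} (hp0 : 0 < p) (hp1 : p ≤ 1) :
    ConvexOn ℝ (Set.Ioi 0) (psiSup p) := by
  refine ⟨convex_Ioi 0, fun x hx y hy a b ha hb hab => ciSup_le fun km => ?_⟩
  simp only [smul_eq_mul]
  rw [psiKM_affine p _ _ x y hab]
  exact add_le_add
    (mul_le_mul_of_nonneg_left (psiKM_le_psiSup hp0 hp1 hx _ _) ha)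
    (mul_le_mul_of_nonneg_left (psiKM_le_psiSup hp0 hp1 hy _ _) hb)

theorem tendsto_psiSup_nhdsGT_zero {p : ℝ} (hp0 : 0 < p) (hp1 : p ≤ 1) :
    Filter.Tendsto (psiSup p) (nhdsWithin 0 (Set.Ioi 0)) Filter.atTop := by
  refine Filter.tendsto_atTop.2 fun c => ?_
  obtain ⟨m, hm⟩ := exists_nat_gt (c / p)
  have hc : c < psiKM p (0 + 1) m 0 := by
    have : c < m * p := (div_lt_iff₀ hp0).1 hm
    simp only [psiKM]
    norm_num
    linarith
  have hcont : Continuous (psiKM p (0 + 1) m) := by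
    unfold psiKM
    fun_prop
  filter_upwards [nhdsWithin_le_nhds (hcont.continuousAt.eventually (lt_mem_nhds hc)),
    self_mem_nhdsWithin] with y hlt hy
  exact hlt.le.trans (psiKM_le_psiSup hp0 hp1 hy 0 m)

theorem tendsto_psiSup_atTop {p : ℝ} (hp0 : 0 < p) (hp1 : p ≤ 1) :
    Filter.Tendsto (psiSup p) Filter.atTop Filter.atTop := by
  refine Filter.tendsto_atTop_mono' _ ?_ Filter.tendsto_id
  filter_upwards [Filter.eventually_gt_atTop 0] with y hy
  refine le_trans ?_ (psiKM_le_psiSup hp0 hp1 hy 0 0)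
  simp [psiKM]

/-- A continuous function on `(0, ∞)` that is coercive at both ends attains its minimum. -/
theorem exists_forall_pos_le_of_tendsto_atTop {f : ℝ → ℝ} (hf : ContinuousOn f (Set.Ioi 0))
    (hzero : Filter.Tendsto f (nhdsWithin 0 (Set.Ioi 0)) Filter.atTop)
    (htop : Filter.Tendsto f Filter.atTop Filter.atTop) :
    ∃ x : ℝ, 0 < x ∧ ∀ y : ℝ, 0 < y → f x ≤ f y := by
  obtain ⟨ε, hε, hleft⟩ := mem_nhdsGT_iff_exists_Ioo_subset.1
    (hzero.eventually (Filter.eventually_ge_atTop (f 1)))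
  obtain ⟨b, hright⟩ := Filter.eventually_atTop.1
    (htop.eventually (Filter.eventually_ge_atTop (f 1)))
  have hpos : 0 < min ε 1 := lt_min hε one_pos
  have hone : (1 : ℝ) ∈ Set.Icc (min ε 1) (max b 1) := ⟨min_le_right _ _, le_max_right _ _⟩
  obtain ⟨x, hx, hmin⟩ := isCompact_Icc.exists_isMinOn ⟨1, hone⟩
    (hf.mono fun z hz => hpos.trans_le hz.1)
  refine ⟨x, hpos.trans_le hx.1, fun y hy => ?_⟩
  rcases lt_or_ge y (min ε 1) with hlt | hge
  · exact (hmin hone).trans (hleft ⟨hy, hlt.trans_le (min_le_left _ _)⟩)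
  rcases le_or_gt y (max b 1) with hle | hgt
  · exact hmin ⟨hge, hle⟩
  · exact (hmin hone).trans (hright y ((le_max_left _ _).trans hgt.le))

/-- For every `p ∈ (0,1]`, the function `ψ_p` is finite (the defining family is
bounded above) and convex on `(0,∞)`, tends to `∞` as `y → 0⁺` and as `y → ∞`,
and attains its minimum over `(0,∞)` at some `y_p > 0`. -/
theorem psi_convex_coercive_attains_min (p : ℝ) (hp0 : 0 < p) (hp1 : p ≤ 1) :
    (∀ y : ℝ, 0 < y →
      BddAbove (Set.range fun km : ℕ × ℕ => psiKM p (km.1 + 1) km.2 y))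
    ∧ ConvexOn ℝ (Set.Ioi 0) (psiSup p)
    ∧ Filter.Tendsto (psiSup p) (nhdsWithin 0 (Set.Ioi 0)) Filter.atTop
    ∧ Filter.Tendsto (psiSup p) Filter.atTop Filter.atTop
    ∧ ∃ yp : ℝ, 0 < yp ∧ ∀ y : ℝ, 0 < y → psiSup p yp ≤ psiSup p y := by
  exact ⟨fun _ hy => bddAbove_range_psiKM hp0 hp1 hy, convexOn_psiSup hp0 hp1,
    tendsto_psiSup_nhdsGT_zero hp0 hp1, tendsto_psiSup_atTop hp0 hp1,
    exists_forall_pos_le_of_tendsto_atTop ((convexOn_psiSup hp0 hp1).continuousOn isOpen_Ioi)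
      (tendsto_psiSup_nhdsGT_zero hp0 hp1) (tendsto_psiSup_atTop hp0 hp1)⟩
end

section
/- For every p ∈ (0,1], the inequality 0 ≤ p·(2k − m − 1)² + m·(1 − 3p) − p holds for all integers k ≥ 1 and m ≥ 0 if and only if p ≤ 1/4. -/
/-- For every `p ∈ (0,1]`, the inequality
`0 ≤ p·(2k − m − 1)² + m·(1 − 3p) − p` holds for all integers `k ≥ 1` and
`m ≥ 0` if and only if `p ≤ 1/4`. -/
theorem quad_nonneg_iff (p : ℝ) (hp0 : 0 < p) (hp1 : p ≤ 1) :
    (∀ k m : ℕ, 1 ≤ k →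
        0 ≤ p * (2 * (k : ℝ) - (m : ℝ) - 1) ^ 2 + (m : ℝ) * (1 - 3 * p) - p)
      ↔ p ≤ 1 / 4 := by
  constructor
  · intro h
    have h11 := h 1 1 le_rfl
    norm_num at h11
    linarith
  · intro hp k m hk
    rcases Nat.eq_zero_or_pos m with rfl | hm
    · have hk' : (1 : ℝ) ≤ k := by exact_mod_cast hk
      have hsq : 0 ≤ p * ((k : ℝ) * (k - 1)) :=
        mul_nonneg hp0.le (mul_nonneg (by linarith) (by linarith))
      push_cast
      linarith
    · have hm' : (1 : ℝ) ≤ m := by exact_mod_cast hm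
      have hsq : 0 ≤ p * (2 * (k : ℝ) - (m : ℝ) - 1) ^ 2 := by positivity
      have hlin : 0 ≤ ((m : ℝ) - 1) * (1 - 3 * p) :=
        mul_nonneg (by linarith) (by linarith)
      linarith
end

section
/- For every p ∈ (0,1], the function ψ_p attains its minimum over (0,∞) at the point y = 1/(1 + 2p + 2√(p(2+p))) if and only if 1/4 ≤ p and 8p³ + 4p² ≤ 1. -/
/-- The numerator form of `V - psiKM p k m y`, with `k` and `m` replaced by real variables. -/
def psiGap (p V y k m : ℝ) : ℝ :=
  V * p * k ^ 2 - (1 + y) * p * k * m + y * p * m ^ 2 + y * (1 - p) * m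
    - k * (1 + y - V * (1 - p))

theorem psiKM_le_iff_psiGap_nonneg {p : ℝ} (hp0 : 0 < p) (k m : ℕ) (y V : ℝ) :
    psiKM p (k + 1) m y ≤ V ↔ 0 ≤ psiGap p V y ((k : ℝ) + 1) m := by
  have hk : (0 : ℝ) ≤ k := k.cast_nonneg
  have hD : 0 < 1 - p + p * ((k : ℝ) + 1) := by nlinarith [mul_nonneg hp0.le hk]
  have hK : 0 < (k : ℝ) + 1 := by linarith
  have key : V - psiKM p (k + 1) m y
      = psiGap p V y ((k : ℝ) + 1) m / (((k : ℝ) + 1) * (1 - p + p * ((k : ℝ) + 1))) := by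
    unfold psiKM psiGap
    push_cast
    rw [eq_div_iff (by positivity)]
    generalize hd : 1 - p + p * ((k : ℝ) + 1) = d at *
    field_simp
    rw [← hd]
    ring
  rw [← sub_nonneg, key]
  exact le_div_iff₀ (by positivity) |>.trans (by rw [zero_mul])

theorem psiSup_le {p V y : ℝ} (hp0 : 0 < p)
    (h : ∀ k m : ℕ, 0 ≤ psiGap p V y ((k : ℝ) + 1) m) : psiSup p y ≤ V :=
  ciSup_le fun km => (psiKM_le_iff_psiGap_nonneg hp0 km.1 km.2 y V).2 (h km.1 km.2)

/-- The value approached along `k → ∞` with `m / k → (1 + y) / (2 * y)` bounds `psiSup` below. -/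
theorem asymptotic_le_psiSup {p y : ℝ} (hp0 : 0 < p) (hp1 : p ≤ 1) (hy : 0 < y) :
    (1 + y) ^ 2 / (4 * y) ≤ psiSup p y := by
  set S := psiSup p y
  by_contra! hlt
  set a := (1 + y) / (2 * y) with ha
  have ha0 : 0 < a := by positivity
  have hya : 2 * y * a = 1 + y := by rw [ha]; field_simp
  have hV : (1 + y) ^ 2 / (4 * y) = y * a ^ 2 := by rw [ha]; field_simp; ring
  rw [hV] at hlt
  set C := y * (1 - p) * a + |1 + y - S * (1 - p)| with hC
  set D := y * p + y * (1 - p) with hD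
  have hδ : 0 < (y * a ^ 2 - S) * p := mul_pos (by linarith) hp0
  obtain ⟨n, hn⟩ := exists_nat_gt ((C + D) / ((y * a ^ 2 - S) * p))
  rw [div_lt_iff₀ hδ] at hn
  have hF := (psiKM_le_iff_psiGap_nonneg hp0 n ⌈a * (n + 1)⌉₊ y S).1
    (psiKM_le_psiSup hp0 hp1 hy n _)
  have hn0 : (0 : ℝ) ≤ n := n.cast_nonneg
  obtain ⟨t, ht⟩ : ∃ t : ℝ, (⌈a * ((n : ℝ) + 1)⌉₊ : ℝ) = a * (n + 1) + t :=
    ⟨_, (add_sub_cancel _ _).symm⟩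
  have ht0 : 0 ≤ t := by have := Nat.le_ceil (a * ((n : ℝ) + 1)); linarith
  have ht1 : t ≤ 1 := by
    have := Nat.ceil_lt_add_one (show 0 ≤ a * ((n : ℝ) + 1) by positivity)
    linarith
  rw [ht] at hF
  generalize hK : (n : ℝ) + 1 = K at *
  have hK1 : 1 ≤ K := by linarith
  have hq : (0 : ℝ) ≤ 1 - p := by linarith
  have e : psiGap p S y K (a * K + t) = -((y * a ^ 2 - S) * p) * K ^ 2 + y * p * t ^ 2
      + y * (1 - p) * t + K * (y * (1 - p) * a - (1 + y - S * (1 - p))) := by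
    unfold psiGap
    rw [← hya]
    ring
  rw [e] at hF
  have h1 : y * p * t ^ 2 ≤ y * p := by
    have : t ^ 2 ≤ 1 := by nlinarith
    nlinarith [mul_pos hy hp0]
  have h2 : y * (1 - p) * t ≤ y * (1 - p) := by
    nlinarith [mul_nonneg hy.le hq]
  have h3 : K * (y * (1 - p) * a - (1 + y - S * (1 - p))) ≤ K * C := by
    apply mul_le_mul_of_nonneg_left _ (by linarith)
    have := neg_abs_le (1 + y - S * (1 - p))
    linarith
  have hD0 : 0 ≤ D := by positivity
  have h4 : D ≤ K * D := by nlinarith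
  have h5 : C + D < K * ((y * a ^ 2 - S) * p) := by nlinarith
  nlinarith [mul_lt_mul_of_pos_left h5 (show 0 < K by linarith)]

theorem one_add_le_psiSup {p y : ℝ} (hp0 : 0 < p) (hp1 : p ≤ 1) (hy : 0 < y) :
    1 + y ≤ psiSup p y := by
  have := psiKM_le_psiSup hp0 hp1 hy 0 0
  simp [psiKM] at this
  linarith

theorem one_add_add_mul_le_psiSup {p y : ℝ} (hp0 : 0 < p) (hp1 : p ≤ 1) (hy : 0 < y) :
    1 + p + p * y ≤ psiSup p y := by
  have := psiKM_le_psiSup hp0 hp1 hy 0 1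
  simp [psiKM] at this
  linarith

theorem one_add_two_mul_sub_le_psiSup {p y : ℝ} (hp0 : 0 < p) (hp1 : p ≤ 1) (hy : 0 < y) :
    1 + 2 * p - y ≤ psiSup p y := by
  have := psiKM_le_psiSup hp0 hp1 hy 0 2
  simp [psiKM] at this
  linarith

/-- For small `p`, the supremum at `1 / 3` is at most the value of the `(1, 0)` line there. -/
theorem psiSup_one_third_le {p : ℝ} (hp0 : 0 < p) (hp : p ≤ 1 / 4) :
    psiSup p (1 / 3) ≤ 4 / 3 := by
  refine psiSup_le hp0 fun k m => ?_
  have hk : (0 : ℝ) ≤ k := k.cast_nonneg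
  have hm : (0 : ℝ) ≤ m := m.cast_nonneg
  have hint : (0 : ℝ) ≤ ((m : ℝ) - 2 * (k + 1) + 1) * (m - 2 * (k + 1) + 2) := by
    have : (0 : ℤ) ≤ ((m : ℤ) - 2 * (k + 1) + 1) * (m - 2 * (k + 1) + 2) := by
      rcases le_or_gt ((m : ℤ) - 2 * (k + 1) + 2) 0 with h | h
      · exact mul_nonneg_of_nonpos_of_nonpos (by linarith) h
      · exact mul_nonneg (by linarith) h.le
    exact_mod_cast this
  have e : psiGap p (4 / 3) (1 / 3) ((k : ℝ) + 1) m
      = (p * (((m : ℝ) - 2 * (k + 1) + 1) * (m - 2 * (k + 1) + 2)) + 2 * p * k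
        + (1 - 4 * p) * m) / 3 := by
    unfold psiGap
    ring
  have hq : 0 ≤ 1 - 4 * p := by linarith
  rw [e]
  positivity

/-- For large `p`, the supremum at the crossing point `p / (1 + p)` of the `(1, 1)` and `(1, 2)`
lines is at most their common value. -/
theorem psiSup_crossing_le {p : ℝ} (hp0 : 0 < p) (hs : 1 ≤ 8 * p ^ 3 + 4 * p ^ 2) :
    psiSup p (p / (1 + p)) ≤ 1 + 2 * p - p / (1 + p) := by
  refine psiSup_le hp0 fun k m => ?_
  have e : psiGap p (1 + 2 * p - p / (1 + p)) (p / (1 + p)) ((k : ℝ) + 1) m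
      = p / (1 + p) * ((1 + 2 * p + 2 * p ^ 2) * ((k : ℝ) + 1) ^ 2
        - (1 + 2 * p) * (k + 1) * m + p * m ^ 2 + (1 - p) * m - (1 + 2 * p ^ 2) * (k + 1)) := by
    unfold psiGap
    field_simp
    ring
  rw [e]
  refine mul_nonneg (by positivity) ?_
  rcases Nat.eq_zero_or_pos k with rfl | hk
  · have hint : (0 : ℝ) ≤ ((m : ℝ) - 1) * (m - 2) := by
      have : (0 : ℤ) ≤ ((m : ℤ) - 1) * (m - 2) := by
        rcases le_or_gt (m : ℤ) 1 with h | h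
        · exact mul_nonneg_of_nonpos_of_nonpos (by linarith) (by linarith)
        · exact mul_nonneg (by linarith) (by linarith)
      exact_mod_cast this
    push_cast
    nlinarith [mul_nonneg hp0.le hint]
  · have hk1 : (1 : ℝ) ≤ k := by exact_mod_cast hk
    generalize hK : (k : ℝ) + 1 = K
    have hK2 : 0 ≤ K - 2 := by linarith
    have hp37 : 37 / 100 ≤ p := by
      by_contra! h
      nlinarith [mul_pos hp0 hp0, mul_pos (mul_pos hp0 hp0) (sub_pos.2 h),
        mul_pos hp0 (sub_pos.2 h)]
    have hb : (1 + p) ^ 2 ≤ 2 * (8 * p ^ 3 + 4 * p ^ 2) := by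
      nlinarith [mul_nonneg (sq_nonneg p) (sub_nonneg.2 hp37),
        mul_nonneg hp0.le (sub_nonneg.2 hp37)]
    have hc : 2 + 2 * p ≤ 3 * (8 * p ^ 3 + 4 * p ^ 2) := by
      nlinarith [mul_nonneg (sq_nonneg p) (sub_nonneg.2 hp37),
        mul_nonneg hp0.le (sub_nonneg.2 hp37)]
    have hdisc : 0 ≤ K ^ 2 * (8 * p ^ 3 + 4 * p ^ 2 - 1)
        - K * (8 * p ^ 3 + 4 * p ^ 2 - 2 + 2 * p) - (1 - p) ^ 2 := by
      nlinarith [mul_nonneg hK2 (sub_nonneg.2 hc),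
        mul_nonneg (sq_nonneg (K - 2)) (sub_nonneg.2 hs)]
    have h4 : 0 ≤ 4 * p * ((1 + 2 * p + 2 * p ^ 2) * K ^ 2
        - (1 + 2 * p) * K * m + p * m ^ 2 + (1 - p) * m - (1 + 2 * p ^ 2) * K) := by
      nlinarith [sq_nonneg (2 * p * m - (1 + 2 * p) * K + (1 - p))]
    exact nonneg_of_mul_nonneg_right h4 (by linarith)

theorem sq_mul_sq_le_of_mem_Icc {y : ℝ} (h0 : 272 / 1000 ≤ y) (h1 : y ≤ 1 / 3) :
    y ^ 2 * (3 * y ^ 2 + 6 * y - 1) ^ 2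
      ≤ 2 * (1 - y) ^ 3 * (1 + y) * (7 * y ^ 2 + 2 * y - 1) := by
  have hs : 0 ≤ y - 272 / 1000 := by linarith
  have ht : 0 ≤ 1 / 3 - y := by linarith
  obtain ⟨s, rfl⟩ : ∃ s, y = s + 272 / 1000 := ⟨y - 272 / 1000, by ring⟩
  simp only [add_sub_cancel_right] at hs
  nlinarith [mul_nonneg hs ht, mul_nonneg (pow_nonneg hs 2) ht, mul_nonneg (pow_nonneg hs 3) ht,
    mul_nonneg (pow_nonneg hs 4) ht, mul_nonneg (pow_nonneg hs 5) ht]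

/-- In the middle range of `p`, the supremum at the point where the `(1, 1)` line meets the
asymptotic curve is at most their common value. -/
theorem psiSup_mid_le {p y : ℝ} (hp : 1 / 4 ≤ p) (hs : 8 * p ^ 3 + 4 * p ^ 2 ≤ 1) (hy : 0 < y)
    (hQ : (4 * p - 1) * y ^ 2 + (2 + 4 * p) * y = 1) :
    psiSup p y ≤ 1 + p + p * y := by
  have hp0 : 0 < p := by linarith
  have hp1 : p < 2 / 5 := by
    by_contra! h
    nlinarith [mul_nonneg (sq_nonneg p) (sub_nonneg.2 h), mul_nonneg hp0.le (sub_nonneg.2 h)]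
  have hupper : y * (1 - p) ≤ p := by
    by_contra! h
    have h1 : 0 < 1 - p := by linarith
    nlinarith [mul_pos h1 (sub_pos.2 h), mul_pos hy h1, mul_nonneg (sub_nonneg.2 hp)
      (mul_pos (sub_pos.2 h) (add_pos (mul_pos hy h1) hp0)).le]
  have hlower : p ≤ (1 + p) * y := by
    by_contra! h
    have h1 : 0 < 1 + p := by linarith
    nlinarith [mul_pos h1 (sub_pos.2 h), mul_pos hy h1, mul_nonneg (sub_nonneg.2 hp)
      (mul_pos (sub_pos.2 h) (add_pos (mul_pos hy h1) hp0)).le]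
  have hpy : p * (4 * y * (1 + y)) = (1 - y) ^ 2 := by linarith
  have hy3 : y ≤ 1 / 3 := by
    by_contra! h
    nlinarith [mul_pos hy (sub_pos.2 h), mul_nonneg (sub_nonneg.2 hp) (sq_nonneg y),
      mul_nonneg (sub_nonneg.2 hp) hy.le]
  have hy272 : 272 / 1000 ≤ y := by
    by_contra! h
    have h2 : (1 - y) ^ 3 ≤ 4 * y ^ 2 * (1 + y) := by
      have : p * (1 - y) ≤ y := by linarith
      nlinarith [mul_le_mul_of_nonneg_right this (show 0 ≤ 4 * y * (1 + y) by positivity)]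
    nlinarith [mul_pos hy (sub_pos.2 h), mul_pos (sq_pos_of_pos hy) (sub_pos.2 h)]
  refine psiSup_le hp0 fun k m => ?_
  rcases Nat.eq_zero_or_pos k with rfl | hk
  · have e : psiGap p (1 + p + p * y) y (((0 : ℕ) : ℝ) + 1) m
        = ((m : ℝ) - 1) * (y * p * m - (p + p * y - y)) := by
      unfold psiGap
      push_cast
      ring
    rw [e]
    rcases m with _ | _ | m
    · push_cast
      linarith
    · simp
    · push_cast
      have hm : (0 : ℝ) ≤ m := m.cast_nonneg
      refine mul_nonneg (by linarith) ?_
      nlinarith [mul_nonneg (mul_nonneg hy.le hp0.le) hm]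
  · have hk1 : (1 : ℝ) ≤ k := by exact_mod_cast hk
    generalize hK : (k : ℝ) + 1 = K
    have hK2 : 0 ≤ K - 2 := by linarith
    have hG : y ^ 2 * (1 - p) ^ 2 ≤ 2 * (p * (1 + y) * ((1 - p) - y * (1 + 3 * p))) := by
      have hw : 0 < 4 * y * (1 + y) := by positivity
      have hpe : p = (1 - y) ^ 2 / (4 * y * (1 + y)) := by
        rw [eq_div_iff hw.ne']; exact hpy
      have hpoly := sq_mul_sq_le_of_mem_Icc hy272 hy3
      have e : 2 * (p * (1 + y) * ((1 - p) - y * (1 + 3 * p))) - y ^ 2 * (1 - p) ^ 2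
          = (2 * (1 - y) ^ 3 * (1 + y) * (7 * y ^ 2 + 2 * y - 1)
            - y ^ 2 * (3 * y ^ 2 + 6 * y - 1) ^ 2) / (4 * y * (1 + y)) ^ 2 := by
        rw [hpe]
        field_simp
        ring
      have : 0 ≤ 2 * (p * (1 + y) * ((1 - p) - y * (1 + 3 * p))) - y ^ 2 * (1 - p) ^ 2 := by
        rw [e]
        exact div_nonneg (by linarith) (by positivity)
      linarith
    have hc : 0 ≤ p * (1 + y) * ((1 - p) - y * (1 + 3 * p)) := by
      nlinarith [mul_nonneg (sq_nonneg y) (sq_nonneg (1 - p))]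
    have hV : 4 * y * (1 + p + p * y) = (1 + y) ^ 2 := by linarith
    have e : 4 * y * p * psiGap p (1 + p + p * y) y K m
        = (2 * y * p * m - (1 + y) * p * K + y * (1 - p)) ^ 2
          + K * (p * (1 + y) * ((1 - p) - y * (1 + 3 * p))) - y ^ 2 * (1 - p) ^ 2 := by
      unfold psiGap
      linear_combination (p ^ 2 * K ^ 2 + p * K * (1 - p)) * hV
    have h4 : 0 ≤ 4 * y * p * psiGap p (1 + p + p * y) y K m := by
      rw [e]
      nlinarith [sq_nonneg (2 * y * p * m - (1 + y) * p * K + y * (1 - p)), mul_nonneg hK2 hc]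
    exact nonneg_of_mul_nonneg_right h4 (by positivity)

/-- For every `p ∈ (0,1]`, `ψ_p` attains its minimum over `(0,∞)` at
`y = 1/(1 + 2p + 2√(p(2+p)))` if and only if `1/4 ≤ p` and `8p³ + 4p² ≤ 1`. -/
theorem psi_min_at_mid_iff (p : ℝ) (hp0 : 0 < p) (hp1 : p ≤ 1) :
    (∀ y : ℝ, 0 < y →
        psiSup p (1 / (1 + 2 * p + 2 * Real.sqrt (p * (2 + p)))) ≤ psiSup p y)
      ↔ (1 / 4 ≤ p ∧ 8 * p ^ 3 + 4 * p ^ 2 ≤ 1) := by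
  have hr : Real.sqrt (p * (2 + p)) ^ 2 = p * (2 + p) := Real.sq_sqrt (by positivity)
  have hr0 := Real.sqrt_nonneg (p * (2 + p))
  generalize Real.sqrt (p * (2 + p)) = r at *
  have hz : 0 < 1 + 2 * p + 2 * r := by linarith
  have hY : 0 < 1 / (1 + 2 * p + 2 * r) := by positivity
  have hQ : (4 * p - 1) * (1 / (1 + 2 * p + 2 * r)) ^ 2
      + (2 + 4 * p) * (1 / (1 + 2 * p + 2 * r)) = 1 := by
    field_simp
    linear_combination (-4) * hr
  generalize 1 / (1 + 2 * p + 2 * r) = Y at *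
  constructor
  · intro h
    constructor
    · by_contra! hlt
      have h1 := h (1 / 3) (by norm_num)
      have h2 := psiSup_one_third_le hp0 hlt.le
      have h3 := one_add_le_psiSup hp0 hp1 hY
      have h4 : Y ≤ 1 / 3 := by linarith
      nlinarith [mul_pos (sub_pos.2 hlt) hY, mul_pos (sub_pos.2 hlt) (sq_pos_of_pos hY),
        mul_nonneg hY.le (sub_nonneg.2 h4)]
    · by_contra! hgt
      have h1 := h (p / (1 + p)) (by positivity)
      have h2 := psiSup_crossing_le hp0 hgt.le
      have h3 := one_add_two_mul_sub_le_psiSup hp0 hp1 hY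
      have h4 : p ≤ Y * (1 + p) := (div_le_iff₀ (by linarith)).1 (by linarith)
      have hp4 : 1 / 4 ≤ p := by
        by_contra! hc
        nlinarith [mul_pos hp0 hp0, mul_pos (mul_pos hp0 hp0) (sub_pos.2 hc)]
      have h6 : 0 ≤ (4 * p - 1) * ((Y * (1 + p)) ^ 2 - p ^ 2) :=
        mul_nonneg (by linarith) (by nlinarith)
      nlinarith [mul_nonneg (show 0 ≤ (2 + 4 * p) * (1 + p) by positivity) (sub_nonneg.2 h4)]
  · rintro ⟨hp, hs⟩ y hy
    have hmid := psiSup_mid_le hp hs hY hQ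
    rcases le_total Y y with hle | hle
    · have := one_add_add_mul_le_psiSup hp0 hp1 hy
      nlinarith [mul_le_mul_of_nonneg_left hle hp0.le]
    · refine hmid.trans (le_trans ?_ (asymptotic_le_psiSup hp0 hp1 hy))
      rw [le_div_iff₀ (by positivity)]
      have hY1 : Y ≤ 1 := by
        nlinarith [mul_nonneg (sub_nonneg.2 hp) (sq_nonneg Y),
          mul_nonneg (sub_nonneg.2 hp) hY.le]
      have hV : 4 * Y * (1 + p + p * Y) = (1 + Y) ^ 2 := by linarith
      have h1 : 0 ≤ (Y - y) * (1 - y * Y) :=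
        mul_nonneg (by linarith) (by nlinarith)
      refine le_of_mul_le_mul_left ?_ hY
      linear_combination h1 + y * hV
end

section
/- For p ∈ (0,1], let z = 1 + p + √(p(2+p)) and define Q_p(k,m) = p·( z·k − m + ((1−p)·z − 2)/(2p) )² + ((1−p)·z − 1 − p)·m − ((1−p)·z − 2)²/(4p). Then Q_p(k,m) ≥ 0 for all integers k ≥ 1 and m ≥ 0 if and only if 1/4 ≤ p and 8p³ + 4p² ≤ 1. -/
/-- `z = 1 + p + √(p(2+p))`. -/
noncomputable def zOf (p : ℝ) : ℝ := 1 + p + Real.sqrt (p * (2 + p))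

/-- `Q_p(k,m) = p·(z·k − m + ((1−p)z − 2)/(2p))² + ((1−p)z − 1 − p)·m
                − ((1−p)z − 2)²/(4p)`. -/
noncomputable def Qp (p : ℝ) (k m : ℕ) : ℝ :=
  p * (zOf p * (k : ℝ) - (m : ℝ) + ((1 - p) * zOf p - 2) / (2 * p)) ^ 2
    + ((1 - p) * zOf p - 1 - p) * (m : ℝ)
    - ((1 - p) * zOf p - 2) ^ 2 / (4 * p)

lemma one_lt_zOf {p : ℝ} (hp : 0 < p) : 1 < zOf p := by
  have := Real.sqrt_nonneg (p * (2 + p))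
  unfold zOf
  linarith

lemma zOf_sub_one_sq {p : ℝ} (hp : 0 < p) : (zOf p - 1) ^ 2 = 2 * zOf p * p := by
  have := Real.sq_sqrt (show 0 ≤ p * (2 + p) by positivity)
  unfold zOf
  linear_combination this

/-- The parameter `p` expressed through `z = zOf p`. -/
lemma eq_zOf_sub_one_sq_div {p : ℝ} (hp : 0 < p) : p = (zOf p - 1) ^ 2 / (2 * zOf p) := by
  have := one_lt_zOf hp
  rw [zOf_sub_one_sq hp]
  field_simp

/-- `2 z Q_p(k,m)` as a polynomial in `z`, `k` and `m`. -/
lemma two_mul_zOf_mul_Qp {p : ℝ} (hp : 0 < p) (k m : ℕ) :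
    2 * zOf p * Qp p k m = (zOf p - 1) ^ 2 * (zOf p * k - m) ^ 2
      - zOf p ^ 2 * ((zOf p - 2) ^ 2 + 1) * k + (3 - (zOf p - 2) ^ 2) * m := by
  have hQ : Qp p k m = p * (zOf p * k - m) ^ 2
      + ((1 - p) * zOf p - 2) * (zOf p * k) + (1 - p) * m := by
    unfold Qp
    field_simp
    ring
  rw [hQ]
  linear_combination (-(zOf p * k - m) ^ 2 + zOf p * (zOf p * k) + m) * zOf_sub_one_sq hp

lemma two_mul_zOf_mul_Qp_one {p : ℝ} (hp : 0 < p) (m : ℕ) :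
    2 * zOf p * Qp p 1 m
      = (m - 1) * ((zOf p - 1) ^ 2 * m - 2 * zOf p ^ 2 * (zOf p - 2)) := by
  rw [two_mul_zOf_mul_Qp hp]
  push_cast
  ring

lemma one_div_four_le_iff_two_le_zOf {p : ℝ} (hp : 0 < p) : 1 / 4 ≤ p ↔ 2 ≤ zOf p := by
  have hz := one_lt_zOf hp
  have h : 2 * zOf p * (4 * p - 1) = 2 * (2 * zOf p - 1) * (zOf p - 2) := by
    linear_combination (-4) * zOf_sub_one_sq hp
  constructor <;> intro _
  · have : 0 ≤ 2 * (2 * zOf p - 1) * (zOf p - 2) := by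
      rw [← h]; exact mul_nonneg (by linarith) (by linarith)
    linarith [nonneg_of_mul_nonneg_right this (by linarith)]
  · have : 0 ≤ 2 * zOf p * (4 * p - 1) := by
      rw [h]; exact mul_nonneg (by linarith) (by linarith)
    linarith [nonneg_of_mul_nonneg_right this (by linarith)]

lemma cubic_le_one_iff {p : ℝ} (hp : 0 < p) :
    8 * p ^ 3 + 4 * p ^ 2 ≤ 1 ↔ (zOf p - 1) ^ 3 ≤ zOf p := by
  have hz := one_lt_zOf hp
  have hz1 : 0 < zOf p - 1 := by linarith
  have h : zOf p ^ 3 * (1 - (8 * p ^ 3 + 4 * p ^ 2))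
      = ((zOf p - 1) ^ 3 + zOf p + (zOf p - 1) * zOf p) * (zOf p - (zOf p - 1) ^ 3) := by
    have hpz := eq_zOf_sub_one_sq_div hp
    generalize zOf p = z at *
    subst hpz
    field_simp
    ring
  have hl : 0 < zOf p ^ 3 := by positivity
  have hr : 0 < (zOf p - 1) ^ 3 + zOf p + (zOf p - 1) * zOf p := by positivity
  rw [← sub_nonneg, ← mul_nonneg_iff_of_pos_left hl, h, mul_nonneg_iff_of_pos_left hr, sub_nonneg]

/-- For `k ≥ 2` the quadratic in `m` has nonpositive discriminant. -/
lemma Qp_nonneg_of_two_le {p : ℝ} (hp : 0 < p) (hz2 : 2 ≤ zOf p)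
    (hz3 : (zOf p - 1) ^ 3 ≤ zOf p) {k : ℕ} (hk : 2 ≤ k) (m : ℕ) : 0 ≤ Qp p k m := by
  have hF := two_mul_zOf_mul_Qp hp k m
  have hk' : (2 : ℝ) ≤ k := by exact_mod_cast hk
  obtain ⟨t, ht⟩ : ∃ t, zOf p = t + 2 := ⟨zOf p - 2, by ring⟩
  rw [ht] at hF hz2 hz3
  have ht0 : 0 ≤ t := by linarith
  have hcub : t ^ 3 + 3 * t ^ 2 + 2 * t ≤ 1 := by
    linarith [show (t + 2 - 1) ^ 3 = t ^ 3 + 3 * t ^ 2 + 3 * t + 1 by ring]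
  have ht1 : t ≤ 1 / 3 := by nlinarith [pow_nonneg ht0 3]
  have hd : 0 ≤ 1 - t - 3 * t ^ 2 - t ^ 3 := by linarith
  have hdisc : (3 - t ^ 2) ^ 2
      ≤ 8 * (t + 2) * (1 - t - 3 * t ^ 2 - t ^ 3) * (t + 1) ^ 2 := by
    have h2 : t ^ 2 ≤ t / 3 := by nlinarith
    have h3 : t ^ 3 ≤ t / 9 := by nlinarith
    have h4 : t ^ 4 ≤ t / 27 := by nlinarith
    have h5 : t ^ 5 ≤ t / 81 := by nlinarith
    have h6 : t ^ 6 ≤ t / 243 := by nlinarith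
    linarith
  have hkd : 0 ≤ (k - 2) * ((t + 2) * (1 - t - 3 * t ^ 2 - t ^ 3)) :=
    mul_nonneg (by linarith) (mul_nonneg (by linarith) hd)
  have key : 0 ≤ 4 * (t + 1) ^ 2 * (2 * (t + 2) * Qp p k m) := by
    rw [hF]
    linarith [sq_nonneg (2 * (t + 1) ^ 2 * ((t + 2) * k - m) - (3 - t ^ 2)),
      mul_nonneg (show 0 ≤ 4 * (t + 1) ^ 2 by positivity) hkd]
  have := nonneg_of_mul_nonneg_right key (by positivity)
  exact nonneg_of_mul_nonneg_right this (by positivity)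

lemma Qp_one_nonneg {p : ℝ} (hp : 0 < p) (hz2 : 2 ≤ zOf p)
    (hz3 : (zOf p - 1) ^ 3 ≤ zOf p) (m : ℕ) : 0 ≤ Qp p 1 m := by
  have hF := two_mul_zOf_mul_Qp_one hp m
  suffices h : 0 ≤ 2 * zOf p * Qp p 1 m from nonneg_of_mul_nonneg_right h (by linarith)
  rw [hF]
  rcases m with _ | _ | m
  · have : 0 ≤ 2 * zOf p ^ 2 * (zOf p - 2) := mul_nonneg (by positivity) (by linarith)
    push_cast
    linarith
  · simp
  · have hm : (0 : ℝ) ≤ m := m.cast_nonneg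
    push_cast
    refine mul_nonneg (by linarith) ?_
    linarith [mul_nonneg (sq_nonneg (zOf p - 1)) hm]

/-- For `p ∈ (0,1]`, one has `Q_p(k,m) ≥ 0` for all integers `k ≥ 1` and `m ≥ 0`
if and only if `1/4 ≤ p` and `8p³ + 4p² ≤ 1`. -/
theorem Qp_nonneg_iff (p : ℝ) (hp0 : 0 < p) (hp1 : p ≤ 1) :
    (∀ k m : ℕ, 1 ≤ k → 0 ≤ Qp p k m)
      ↔ (1 / 4 ≤ p ∧ 8 * p ^ 3 + 4 * p ^ 2 ≤ 1) := by
  have hz := one_lt_zOf hp0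
  rw [one_div_four_le_iff_two_le_zOf hp0, cubic_le_one_iff hp0]
  constructor
  · intro h
    have hF (m : ℕ) : 0 ≤ (m - 1) * ((zOf p - 1) ^ 2 * m - 2 * zOf p ^ 2 * (zOf p - 2)) := by
      rw [← two_mul_zOf_mul_Qp_one hp0]
      exact mul_nonneg (by linarith) (h 1 m le_rfl)
    have h0 := hF 0
    have h2 := hF 2
    push_cast at h0 h2
    constructor
    · have : 0 ≤ 2 * zOf p ^ 2 * (zOf p - 2) := by linarith
      linarith [nonneg_of_mul_nonneg_right this (by positivity)]
    · linarith
  · rintro ⟨hz2, hz3⟩ k m hk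
    rcases hk.eq_or_lt with rfl | hk
    · exact Qp_one_nonneg hp0 hz2 hz3 m
    · exact Qp_nonneg_of_two_le hp0 hz2 hz3 hk m
end

section
/- Let Γ be a Bernoulli congestion game with affine costs c_e(x) = a_e·x + b_e where a_e, b_e ≥ 0, and homogeneous participation probabilities p_i = p for all players, with p ∈ (0,1]. Then for every pure Bayes–Nash equilibrium s* and every strategy profile s', the expected social cost satisfies C(s*) ≤ B(p)·C(s'), where B(p) = 4/3 if p ≤ 1/4; B(p) = (1 + p + √(p(2+p)))/(1 − p + √(p(2+p))) if 1/4 ≤ p and 8p³+4p² ≤ 1; and B(p) = 1 + p + p²/(1+p) if 8p³+4p² ≥ 1. -/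
open Finset

/-- The price-of-anarchy bound `B(p)`:
`4/3` for `p ≤ 1/4`, `(1 + p + √(p(2+p)))/(1 − p + √(p(2+p)))` for
`1/4 ≤ p` with `8p³+4p² ≤ 1`, and `1 + p + p²/(1+p)` for `8p³+4p² ≥ 1`. -/
noncomputable def Bpoa (p : ℝ) : ℝ :=
  if p ≤ 1 / 4 then 4 / 3
  else if 8 * p ^ 3 + 4 * p ^ 2 ≤ 1 then
    (1 + p + Real.sqrt (p * (2 + p))) / (1 - p + Real.sqrt (p * (2 + p)))
  else 1 + p + p ^ 2 / (1 + p)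

/-- The total probability of the active sets containing `T` is `p ^ #T`. -/
theorem sum_probOf_superset {ι : Type*} [Fintype ι] [DecidableEq ι] (p : ℝ) (T : Finset ι) :
    ∑ I : Finset ι, (if T ⊆ I then probOf (fun _ => p) I else 0) = p ^ T.card := by
  have h := Finset.prod_add (fun _ : ι => p) (fun j => if j ∈ T then 0 else 1 - p) univ
  have hl : ∏ j : ι, (p + if j ∈ T then 0 else 1 - p) = p ^ T.card := by
    rw [← Finset.prod_const, ← Finset.prod_subset (Finset.subset_univ T)]
    · exact Finset.prod_congr rfl fun j hj => by simp [hj]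
    · intro j _ hj
      simp [hj]
  rw [← hl, h, Finset.powerset_univ]
  refine Finset.sum_congr rfl fun I _ => ?_
  rw [← Finset.compl_eq_univ_sdiff]
  split_ifs with hT
  · unfold probOf
    congr 1
    refine Finset.prod_congr rfl fun j hj => ?_
    rw [if_neg fun hjT => Finset.mem_compl.1 hj (hT hjT)]
  · obtain ⟨j, hjT, hjI⟩ := Finset.not_subset.1 hT
    rw [Finset.prod_eq_zero (Finset.mem_compl.2 hjI) (by simp [hjT]), mul_zero]

/-- Expected cost of an affine resource to a player `i` using it. -/
theorem sum_probOf_affine_load {ι E : Type*} [Fintype ι] [DecidableEq ι] [DecidableEq E]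
    (p α β : ℝ) (s : ι → Finset E) (i : ι) (e : E) (he : e ∈ s i) :
    ∑ I ∈ (univ : Finset (Finset ι)).filter (fun I => i ∈ I),
        probOf (fun _ => p) I * (α * (load s I e : ℝ) + β)
      = p * (α * (1 - p + p * (load s univ e : ℝ)) + β) := by
  have hone : ∑ I : Finset ι, (if i ∈ I then probOf (fun _ => p) I else 0) = p := by
    simpa using sum_probOf_superset p {i}
  have hpair (j : ι) : ∑ I : Finset ι, (if i ∈ I ∧ j ∈ I then probOf (fun _ => p) I else 0)
      = p ^ 2 + if i = j then p - p ^ 2 else 0 := by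
    have h := sum_probOf_superset p {i, j}
    simp only [Finset.insert_subset_iff, Finset.singleton_subset_iff] at h
    rw [h]
    split_ifs with hij
    · simp [hij]
    · simp [Finset.card_pair hij]
  have hload (I : Finset ι) :
      (load s I e : ℝ) = ∑ j ∈ univ.filter (fun j => e ∈ s j), if j ∈ I then (1 : ℝ) else 0 := by
    unfold load
    rw [Finset.sum_boole]
    congr 2
    ext j
    simp [and_comm]
  have hsum : ∑ I : Finset ι, (if i ∈ I then probOf (fun _ => p) I * (load s I e : ℝ) else 0)
      = p * (1 - p + p * (load s univ e : ℝ)) := by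
    calc _ = ∑ I : Finset ι, ∑ j ∈ univ.filter (fun j => e ∈ s j),
          (if i ∈ I ∧ j ∈ I then probOf (fun _ => p) I else 0) := by
          refine Finset.sum_congr rfl fun I _ => ?_
          rw [hload, Finset.mul_sum]
          by_cases hi : i ∈ I <;> simp [hi]
      _ = ∑ j ∈ univ.filter (fun j => e ∈ s j), (p ^ 2 + if i = j then p - p ^ 2 else 0) := by
          rw [Finset.sum_comm]
          exact Finset.sum_congr rfl fun j _ => hpair j
      _ = _ := by
          rw [Finset.sum_add_distrib, Finset.sum_ite_eq, if_pos (by simpa using he)]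
          simp only [Finset.sum_const, nsmul_eq_mul, load]
          ring
  calc _ = α * ∑ I : Finset ι, (if i ∈ I then probOf (fun _ => p) I * (load s I e : ℝ) else 0)
        + β * ∑ I : Finset ι, (if i ∈ I then probOf (fun _ => p) I else 0) := by
        rw [Finset.sum_filter, Finset.mul_sum, Finset.mul_sum, ← Finset.sum_add_distrib]
        refine Finset.sum_congr rfl fun I _ => ?_
        split_ifs <;> ring
    _ = _ := by rw [hsum, hone]; ring

theorem playerCost_affine {ι E : Type*} [Fintype ι] [DecidableEq ι] [DecidableEq E]
    (a b : E → ℝ) (p : ℝ) (s : ι → Finset E) (i : ι) :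
    playerCost (fun _ => p) (fun e x => a e * (x : ℝ) + b e) s i
      = ∑ e ∈ s i, p * (a e * (1 - p + p * (load s univ e : ℝ)) + b e) :=
  Finset.sum_congr rfl fun e he => sum_probOf_affine_load p (a e) (b e) s i e he

theorem sum_sum_mem_eq_sum_load_mul {ι E : Type*} [Fintype ι] [Fintype E] [DecidableEq E]
    (s : ι → Finset E) (h : E → ℝ) :
    ∑ i, ∑ e ∈ s i, h e = ∑ e, (load s univ e : ℝ) * h e := by
  calc _ = ∑ i, ∑ e, if e ∈ s i then h e else 0 := by simp
    _ = _ := by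
      rw [Finset.sum_comm]
      refine Finset.sum_congr rfl fun e _ => ?_
      rw [← Finset.sum_filter, Finset.sum_const, nsmul_eq_mul, load]

theorem load_update_le {ι E : Type*} [Fintype ι] [DecidableEq ι] [DecidableEq E]
    (s : ι → Finset E) (i : ι) (t : Finset E) (e : E) :
    load (Function.update s i t) univ e ≤ load s univ e + 1 := by
  unfold load
  refine (Finset.card_le_card (t := insert i (univ.filter fun j => e ∈ s j)) ?_).trans
    (Finset.card_insert_le _ _)
  intro j hj
  by_cases hji : j = i
  · simp [hji]
  · simpa [hji] using hj

/-- The smoothness inequality for `p ≤ 1/4`, with parameters `λ = 1` and `μ = 1/4`. -/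
theorem smooth_of_le_quarter {p : ℝ} (hp0 : 0 < p) (hp : p ≤ 1 / 4) (x y : ℕ) :
    (y : ℝ) * (1 + p * x)
      ≤ 1 * (y * (1 - p + p * y)) + 1 / 4 * (x * (1 - p + p * x)) := by
  have key : 0 ≤ (2 * (y : ℝ) - x) ^ 2 - 4 * y + 3 * x := by
    rcases Nat.eq_zero_or_pos x with rfl | hx
    · rcases Nat.eq_zero_or_pos y with rfl | hy
      · simp
      · have : (1 : ℝ) ≤ y := by exact_mod_cast hy
        push_cast
        nlinarith
    · have : (1 : ℝ) ≤ x := by exact_mod_cast hx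
      nlinarith [sq_nonneg (2 * (y : ℝ) - x - 1)]
  have hx : (0 : ℝ) ≤ x := Nat.cast_nonneg x
  nlinarith [mul_nonneg hp0.le key, mul_nonneg (sub_nonneg.2 hp) hx]

/-- The smoothness inequality in the intermediate range, with
`λ = (1 + p + q) / 2` and `μ = (1 + p - q) / 2`, where `q = √(p (2 + p))`. -/
theorem smooth_of_quarter_lt {p q : ℝ} (hp : 1 / 4 < p) (hpc : 8 * p ^ 3 + 4 * p ^ 2 ≤ 1)
    (hq0 : 0 ≤ q) (hq : q ^ 2 = p * (2 + p)) (x y : ℕ) :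
    (y : ℝ) * (1 + p * x)
      ≤ (1 + p + q) / 2 * (y * (1 - p + p * y))
        + (1 + p - q) / 2 * (x * (1 - p + p * x)) := by
  have hp' : p < 19 / 50 := by
    by_contra! h
    nlinarith [mul_nonneg (sub_nonneg.2 h) (sub_nonneg.2 h), pow_le_pow_left₀ (by norm_num) h 3,
      pow_le_pow_left₀ (by norm_num) h 2]
  have hql : 3 / 8 + 3 / 2 * p ≤ q := by
    refine le_of_sq_le_sq ?_ hq0
    nlinarith
  have hqu : q * (1 + 2 * p) ≤ 1 + p + 2 * p ^ 2 := by
    refine le_of_sq_le_sq ?_ (by positivity)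
    rw [mul_pow, hq]
    nlinarith
  have hmu : 0 < 1 + p - q := by
    nlinarith
  have hx0 : (0 : ℝ) ≤ x := Nat.cast_nonneg x
  obtain rfl | rfl | hy : y = 0 ∨ y = 1 ∨ 2 ≤ y := by omega
  · have : 0 ≤ (1 + p - q) / 2 * (x * (1 - p + p * x)) := by
      have : 0 ≤ 1 - p + p * x := by nlinarith
      positivity
    simpa using this
  · have hfac : (1 + p + q) / 2 * ((1 : ℕ) * (1 - p + p * (1 : ℕ)))
        + (1 + p - q) / 2 * (x * (1 - p + p * x)) - (1 : ℕ) * (1 + p * x)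
        = ((x : ℝ) - 1) * ((1 + p - q) / 2 * p * x - (p + q - 1) / 2) := by
      push_cast
      ring
    rw [← sub_nonneg, hfac]
    obtain rfl | rfl | hx : x = 0 ∨ x = 1 ∨ 2 ≤ x := by omega
    · push_cast
      linarith
    · simp
    · have hx' : (2 : ℝ) ≤ x := by exact_mod_cast hx
      refine mul_nonneg (by linarith) ?_
      have : 0 ≤ (1 + p - q) * p * (x - 2) :=
        mul_nonneg (mul_nonneg hmu.le (by linarith)) (by linarith)
      nlinarith
  · have hy' : (2 : ℝ) ≤ y := by exact_mod_cast hy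
    set l := (1 + p + q) / 2 with hl
    set t := (y : ℝ) - (1 + p - q) * x with ht
    set A := ((1 - p) * q - p * (1 + p)) / 2 with hA
    have hApos : 0 ≤ A := by
      rw [hA]
      nlinarith
    have hlpos : 0 < l := by
      rw [hl]
      linarith
    have hdisc : (1 - p) ^ 2 ≤ 32 * p * l * A := by
      have hexp : 32 * p * l * A
          = 8 * p * (q * ((1 + p) * (1 - 2 * p)) + p * (1 - 3 * p - 2 * p ^ 2)) := by
        rw [hl, hA]
        linear_combination 8 * p * (1 - p) * hq
      have hpos : 0 ≤ (1 + p) * (1 - 2 * p) := by nlinarith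
      have h1 := mul_le_mul_of_nonneg_right hql hpos
      have h2 := mul_le_mul_of_nonneg_left h1 (by linarith : 0 ≤ 8 * p)
      have h3 : (1 - p) ^ 2 ≤ 8 * p * ((3 / 8 + 3 / 2 * p) * ((1 + p) * (1 - 2 * p))
          + p * (1 - 3 * p - 2 * p ^ 2)) := by
        nlinarith [mul_nonneg (sub_nonneg.2 hp.le) (sub_nonneg.2 hp'.le),
          mul_nonneg (mul_nonneg (sub_nonneg.2 hp.le) (sub_nonneg.2 hp'.le)) (sq_nonneg p),
          mul_nonneg (mul_nonneg (sub_nonneg.2 hp.le) (sub_nonneg.2 hp'.le)) (by linarith : 0 ≤ p)]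
      linarith
    have hAy : 0 ≤ 16 * p * l * A * (y - 2) := by
      have : 0 ≤ (y : ℝ) - 2 := by linarith
      positivity
    have hid : 16 * p * l * (l * (y * (1 - p + p * y))
          + (1 + p - q) / 2 * (x * (1 - p + p * x)) - y * (1 + p * x))
        = (4 * p * l * t - (1 - p)) ^ 2 - (1 - p) ^ 2 + 16 * p * l * A * y := by
      rw [hl, ht, hA]
      linear_combination
        -(16 * p * ((1 + p + q) / 2) * (p * x * y - p * ((1 + p - q) / 2) * x ^ 2)) * hq
    have : 0 ≤ 16 * p * l * (l * (y * (1 - p + p * y))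
          + (1 + p - q) / 2 * (x * (1 - p + p * x)) - y * (1 + p * x)) := by
      rw [hid]
      nlinarith [sq_nonneg (4 * p * l * t - (1 - p))]
    have := nonneg_of_mul_nonneg_right this (by positivity)
    linarith

/-- The smoothness inequality for large `p`, scaled by `1 + 2p`, with
`λ = (1 + 2p + 2p²) / (1 + 2p)` and `μ = p / (1 + 2p)`. -/
theorem smooth_of_one_lt {p : ℝ} (hp0 : 0 < p) (hp1 : p ≤ 1) (hpc : 1 < 8 * p ^ 3 + 4 * p ^ 2)
    (x y : ℕ) :
    (1 + 2 * p) * ((y : ℝ) * (1 + p * x))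
      ≤ (1 + 2 * p + 2 * p ^ 2) * (y * (1 - p + p * y)) + p * (x * (1 - p + p * x)) := by
  have hp : 37 / 100 < p := by
    by_contra! h
    nlinarith [pow_le_pow_left₀ hp0.le h 3, pow_le_pow_left₀ hp0.le h 2]
  have hx0 : (0 : ℝ) ≤ x := Nat.cast_nonneg x
  suffices h : 0 ≤ p * x ^ 2 + (1 - p - (1 + 2 * p) * y) * x
      + ((1 + 2 * p + 2 * p ^ 2) * (y : ℝ) ^ 2 - (1 + 2 * p ^ 2) * y) by
    nlinarith [mul_nonneg hp0.le h]
  obtain rfl | rfl | hy : y = 0 ∨ y = 1 ∨ 2 ≤ y := by omega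
  · push_cast
    nlinarith [mul_nonneg hx0 (sub_nonneg.2 hp1), mul_nonneg hp0.le (sq_nonneg (x : ℝ))]
  · have h : 0 ≤ ((x : ℝ) - 1) * (x - 2) := by
      obtain rfl | rfl | hx : x = 0 ∨ x = 1 ∨ 2 ≤ x := by omega
      · norm_num
      · simp
      · have hx' : (2 : ℝ) ≤ x := by exact_mod_cast hx
        exact mul_nonneg (by linarith) (by linarith)
    push_cast
    nlinarith [mul_nonneg hp0.le h]
  · have hy' : (0 : ℝ) ≤ y - 2 := by
      have : (2 : ℝ) ≤ y := by exact_mod_cast hy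
      linarith
    have hat : 1 + 2 * p - 7 * p ^ 2 - 16 * p ^ 3 ≤ 0 := by
      rcases le_total p (2 / 5) with h | h
      · nlinarith
      · nlinarith [pow_le_pow_left₀ (by norm_num) h 3, pow_le_pow_left₀ (by norm_num) h 2]
    have hslope : 2 + 2 * p - 12 * p ^ 2 - 24 * p ^ 3 ≤ 0 := by
      rcases le_total p (1 / 2) with h | h
      · nlinarith
      · nlinarith [pow_le_pow_left₀ (by norm_num) h 3, pow_le_pow_left₀ (by norm_num) h 2]
    have hdisc : (1 - p - (1 + 2 * p) * y) ^ 2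
        ≤ 4 * p * ((1 + 2 * p + 2 * p ^ 2) * (y : ℝ) ^ 2 - (1 + 2 * p ^ 2) * y) := by
      nlinarith [mul_nonneg (sub_nonneg.2 hpc.le) (sq_nonneg ((y : ℝ) - 2)),
        mul_nonneg (neg_nonneg.2 hslope) hy']
    have hsq : 0 ≤ 4 * p * (p * x ^ 2 + (1 - p - (1 + 2 * p) * y) * x
        + ((1 + 2 * p + 2 * p ^ 2) * (y : ℝ) ^ 2 - (1 + 2 * p ^ 2) * y)) := by
      nlinarith [sq_nonneg (2 * p * x + (1 - p - (1 + 2 * p) * y))]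
    exact nonneg_of_mul_nonneg_right hsq (by positivity)

/-- Smoothness parameters `(l, m)` that yield the bound `Bpoa p = l / (1 - m)`. -/
theorem exists_smooth_parameters {p : ℝ} (hp0 : 0 < p) (hp1 : p ≤ 1) :
    ∃ l m : ℝ, 1 ≤ l ∧ 0 ≤ m ∧ m < 1 ∧ Bpoa p = l / (1 - m) ∧
      ∀ x y : ℕ, (y : ℝ) * (1 + p * x)
        ≤ l * (y * (1 - p + p * y)) + m * (x * (1 - p + p * x)) := by
  unfold Bpoa
  split_ifs with h1 h2
  · exact ⟨1, 1 / 4, le_rfl, by norm_num, by norm_num, by norm_num, smooth_of_le_quarter hp0 h1⟩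
  · have hq : √(p * (2 + p)) ^ 2 = p * (2 + p) := Real.sq_sqrt (by positivity)
    have hq0 : 0 ≤ √(p * (2 + p)) := Real.sqrt_nonneg _
    set q := √(p * (2 + p))
    push Not at h1
    have hlow : 1 - p ≤ q := le_of_sq_le_sq (by nlinarith) hq0
    have hup : q ≤ 1 + p := le_of_sq_le_sq (by nlinarith) (by linarith)
    have hpos : 0 < 1 - p + q := by nlinarith
    refine ⟨(1 + p + q) / 2, (1 + p - q) / 2, by linarith, by linarith, by linarith, ?_,
      smooth_of_quarter_lt h1 h2 hq0 hq⟩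
    rw [show 1 - (1 + p - q) / 2 = (1 - p + q) / 2 by ring]
    field_simp
  · push Not at h2
    have hd : 0 < 1 + 2 * p := by linarith
    refine ⟨(1 + 2 * p + 2 * p ^ 2) / (1 + 2 * p), p / (1 + 2 * p), ?_, by positivity, ?_, ?_, ?_⟩
    · rw [le_div_iff₀ hd]
      nlinarith
    · rw [div_lt_one hd]
      linarith
    · rw [show 1 - p / (1 + 2 * p) = (1 + p) / (1 + 2 * p) by field_simp; ring]
      field_simp
      ring
    · intro x y
      rw [div_mul_eq_mul_div, div_mul_eq_mul_div, ← add_div, le_div_iff₀ hd, mul_comm]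
      exact smooth_of_one_lt hp0 hp1 h2 x y

/-- In a Bernoulli congestion game with affine costs `c_e(x) = a_e·x + b_e`
(`a_e, b_e ≥ 0`) and homogeneous participation probability `p ∈ (0,1]`, the
expected social cost of every pure Bayes–Nash equilibrium `s*` is at most
`B(p)` times the expected social cost of any strategy profile `s'`. -/
theorem bernoulli_affine_poa
    {ι E : Type*} [Fintype ι] [DecidableEq ι] [Fintype E] [DecidableEq E]
    (S : ι → Finset (Finset E)) (a b : E → ℝ) (p : ℝ)
    (hS : ∀ i, (S i).Nonempty) (ha : ∀ e, 0 ≤ a e) (hb : ∀ e, 0 ≤ b e)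
    (hp0 : 0 < p) (hp1 : p ≤ 1)
    (sstar s' : ι → Finset E)
    (hstar : ∀ i, sstar i ∈ S i) (hs' : ∀ i, s' i ∈ S i)
    (heq : ∀ i, ∀ si ∈ S i,
      playerCost (fun _ => p) (fun e x => a e * (x : ℝ) + b e) sstar i
        ≤ playerCost (fun _ => p) (fun e x => a e * (x : ℝ) + b e)
            (Function.update sstar i si) i) :
    ∑ i, playerCost (fun _ => p) (fun e x => a e * (x : ℝ) + b e) sstar i
      ≤ Bpoa p * ∑ i, playerCost (fun _ => p) (fun e x => a e * (x : ℝ) + b e) s' i := by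
  obtain ⟨l, m, hl, hm, hm1, hB, hsmooth⟩ := exists_smooth_parameters hp0 hp1
  have hsocial (s : ι → Finset E) :
      ∑ i, playerCost (fun _ => p) (fun e x => a e * (x : ℝ) + b e) s i
        = ∑ e, (load s univ e : ℝ) * (p * (a e * (1 - p + p * (load s univ e : ℝ)) + b e)) := by
    rw [← sum_sum_mem_eq_sum_load_mul]
    exact Finset.sum_congr rfl fun i _ => playerCost_affine a b p s i
  have hdev : ∑ i, playerCost (fun _ => p) (fun e x => a e * (x : ℝ) + b e) sstar i
      ≤ ∑ e, (load s' univ e : ℝ) * (p * (a e * (1 + p * (load sstar univ e : ℝ)) + b e)) := by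
    rw [← sum_sum_mem_eq_sum_load_mul]
    refine Finset.sum_le_sum fun i _ => (heq i (s' i) (hs' i)).trans ?_
    rw [playerCost_affine, Function.update_self]
    refine Finset.sum_le_sum fun e _ => ?_
    have hload : (load (Function.update sstar i (s' i)) univ e : ℝ) ≤ load sstar univ e + 1 := by
      exact_mod_cast load_update_le sstar i (s' i) e
    have := mul_le_mul_of_nonneg_left hload hp0.le
    refine mul_le_mul_of_nonneg_left ?_ hp0.le
    have := mul_le_mul_of_nonneg_left
      (show 1 - p + p * (load (Function.update sstar i (s' i)) univ e : ℝ)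
        ≤ 1 + p * (load sstar univ e : ℝ) by linarith) (ha e)
    linarith
  have hmain : ∑ e, (load s' univ e : ℝ) * (p * (a e * (1 + p * (load sstar univ e : ℝ)) + b e))
      ≤ l * ∑ i, playerCost (fun _ => p) (fun e x => a e * (x : ℝ) + b e) s' i
        + m * ∑ i, playerCost (fun _ => p) (fun e x => a e * (x : ℝ) + b e) sstar i := by
    rw [hsocial, hsocial, Finset.mul_sum, Finset.mul_sum, ← Finset.sum_add_distrib]
    refine Finset.sum_le_sum fun e _ => ?_
    have hx : (0 : ℝ) ≤ load sstar univ e := Nat.cast_nonneg _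
    have hy : (0 : ℝ) ≤ load s' univ e := Nat.cast_nonneg _
    have hlin := mul_le_mul_of_nonneg_left (hsmooth (load sstar univ e) (load s' univ e))
      (mul_nonneg hp0.le (ha e))
    have hconst : (load s' univ e : ℝ) ≤ l * load s' univ e + m * load sstar univ e := by
      nlinarith [mul_nonneg (sub_nonneg.2 hl) hy, mul_nonneg hm hx]
    have := mul_le_mul_of_nonneg_left hconst (mul_nonneg hp0.le (hb e))
    linarith
  rw [hB, div_mul_eq_mul_div, le_div_iff₀ (by linarith)]
  linarith
end

section
/- Let S be a finite set, c : ℕ → ℝ a function, q ∈ [0,1], and r_j ∈ [0,1] for each j ∈ S. Then q · Σ_{T ⊆ S} ( ∏_{j∈T} (r_j·q) · ∏_{j∈S\T} (1 − r_j·q) ) · c(1 + |T|) = Σ_{T ⊆ S} ( ∏_{j∈T} r_j · ∏_{j∈S\T} (1 − r_j) ) · c^q(1 + |T|). (Probabilistically: if Y_j ~ Bernoulli(r_j) and Z_j ~ Bernoulli(q) are all independent, then q·E[c(1 + Σ_{j∈S} Z_j Y_j)] = E[c^q(1 + Σ_{j∈S} Y_j)].) -/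
open Finset

/-- The Bernoulli-adjusted cost: for `x ≥ 1`,
`c^q(x) = q · Σ_{j=0}^{x−1} C(x−1,j) · q^j · (1−q)^{x−1−j} · c(1+j)`,
i.e. `c^q(x) = q·E[c(1+X)]` with `X ~ Binomial(x−1, q)`. -/
noncomputable def adjCost (c : ℕ → ℝ) (q : ℝ) (x : ℕ) : ℝ :=
  q * ∑ j ∈ Finset.range x,
    ((x - 1).choose j : ℝ) * q ^ j * (1 - q) ^ (x - 1 - j) * c (1 + j)

/-- The expectation of `f |T|` when each `j ∈ S` is put into `T` independently with probability
`p j`. -/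
noncomputable def poissonBinomialSum {ι : Type*} [DecidableEq ι] (p : ι → ℝ) (S : Finset ι) (f : ℕ → ℝ) : ℝ :=
  ∑ T ∈ S.powerset, ((∏ j ∈ T, p j) * ∏ j ∈ S \ T, (1 - p j)) * f T.card

theorem poissonBinomialSum_insert {ι : Type*} [DecidableEq ι] (p : ι → ℝ) {S : Finset ι} {a : ι}
    (ha : a ∉ S) (f : ℕ → ℝ) :
    poissonBinomialSum p (insert a S) f =
      (1 - p a) * poissonBinomialSum p S f + p a * poissonBinomialSum p S (fun n => f (n + 1)) := by
  unfold poissonBinomialSum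
  rw [Finset.sum_powerset_insert ha, Finset.mul_sum, Finset.mul_sum]
  congr 1 <;> refine Finset.sum_congr rfl fun T hT => ?_
  · have haT : a ∉ T := fun h => ha (Finset.mem_powerset.1 hT h)
    rw [Finset.insert_sdiff_of_notMem _ haT, Finset.prod_insert (by simp [ha])]
    ring
  · have haT : a ∉ T := fun h => ha (Finset.mem_powerset.1 hT h)
    rw [Finset.insert_sdiff_insert, Finset.sdiff_insert_of_notMem ha, Finset.prod_insert haT,
      Finset.card_insert_of_notMem haT]
    ring

theorem poissonBinomialSum_const {ι : Type*} [DecidableEq ι] (q : ℝ) (S : Finset ι) (f : ℕ → ℝ) :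
    poissonBinomialSum (fun _ => q) S f =
      ∑ j ∈ Finset.range (S.card + 1),
        (S.card.choose j : ℝ) * q ^ j * (1 - q) ^ (S.card - j) * f j := by
  have h := Finset.sum_powerset_apply_card
    (fun j => q ^ j * (1 - q) ^ (S.card - j) * f j) (x := S)
  simp only [nsmul_eq_mul, ← mul_assoc] at h
  rw [← h]
  refine Finset.sum_congr rfl fun T hT => ?_
  rw [Finset.prod_const, Finset.prod_const, Finset.card_sdiff_of_subset (Finset.mem_powerset.1 hT)]

theorem adjCost_one_add_card {ι : Type*} [DecidableEq ι] (c : ℕ → ℝ) (q : ℝ) (S : Finset ι) :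
    adjCost c q (1 + S.card) = q * poissonBinomialSum (fun _ => q) S (fun n => c (1 + n)) := by
  rw [poissonBinomialSum_const, adjCost, Nat.add_sub_cancel_left, Nat.add_comm 1 S.card]

theorem poissonBinomialSum_mul_const {ι : Type*} [DecidableEq ι] (r : ι → ℝ) (q : ℝ)
    (S : Finset ι) (f : ℕ → ℝ) :
    poissonBinomialSum (fun j => r j * q) S f =
      ∑ T ∈ S.powerset, ((∏ j ∈ T, r j) * ∏ j ∈ S \ T, (1 - r j)) *
        poissonBinomialSum (fun _ => q) T f := by
  induction S using Finset.induction_on generalizing f with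
  | empty => simp [poissonBinomialSum]
  | insert a S ha ih =>
    rw [poissonBinomialSum_insert _ ha, ih, ih, Finset.sum_powerset_insert ha, Finset.mul_sum,
      Finset.mul_sum, ← Finset.sum_add_distrib, ← Finset.sum_add_distrib]
    refine Finset.sum_congr rfl fun T hT => ?_
    have haT : a ∉ T := fun h => ha (Finset.mem_powerset.1 hT h)
    rw [Finset.insert_sdiff_of_notMem _ haT, Finset.prod_insert (by simp [ha]),
      Finset.insert_sdiff_insert, Finset.sdiff_insert_of_notMem ha, Finset.prod_insert haT,
      poissonBinomialSum_insert _ haT]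
    ring

/-- Thinning identity: for a finite set `S`, `q ∈ [0,1]` and `r_j ∈ [0,1]`,
`q · Σ_{T ⊆ S} (∏_{j∈T} r_j·q · ∏_{j∈S\T} (1 − r_j·q)) · c(1 + |T|)
  = Σ_{T ⊆ S} (∏_{j∈T} r_j · ∏_{j∈S\T} (1 − r_j)) · c^q(1 + |T|)`.
Probabilistically: if `Y_j ~ Bernoulli(r_j)` and `Z_j ~ Bernoulli(q)` are all
independent, then `q·E[c(1 + Σ_j Z_j Y_j)] = E[c^q(1 + Σ_j Y_j)]`. -/
theorem bernoulli_thinning {ι : Type*} [Fintype ι] [DecidableEq ι]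
    (c : ℕ → ℝ) (q : ℝ) (hq : q ∈ Set.Icc (0 : ℝ) 1)
    (r : ι → ℝ) (hr : ∀ j, r j ∈ Set.Icc (0 : ℝ) 1) :
    q * ∑ T : Finset ι,
        ((∏ j ∈ T, (r j * q)) * ∏ j ∈ Tᶜ, (1 - r j * q)) * c (1 + T.card)
      = ∑ T : Finset ι,
          ((∏ j ∈ T, r j) * ∏ j ∈ Tᶜ, (1 - r j)) * adjCost c q (1 + T.card) := by
  have h := poissonBinomialSum_mul_const r q Finset.univ (fun n => c (1 + n))
  simp only [Finset.powerset_univ, ← Finset.compl_eq_univ_sdiff] at h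
  calc
    _ = q * poissonBinomialSum (fun j => r j * q) Finset.univ (fun n => c (1 + n)) := by
      simp only [poissonBinomialSum, Finset.powerset_univ, ← Finset.compl_eq_univ_sdiff]
    _ = _ := by
      rw [h, Finset.mul_sum]
      refine Finset.sum_congr rfl fun T _ => ?_
      rw [adjCost_one_add_card]
      ring
end

section
/- Let c : ℕ → ℝ be nonnegative, let n ≥ 1 be an integer, σ ≥ 1 a constant with c(k) ≤ σ·c(1) for all 1 ≤ k ≤ n, and let q ∈ (0,1). Then for all integers k and m with 1 ≤ k ≤ n and 0 ≤ m ≤ n − 1, one has c^q(m+1) ≤ (1−q)^{−n}·(1 + σ·(1 − (1−q)^n))·c^q(k). (In particular the factor λ(q) = (1−q)^{−n}·(1 + σ·(1 − (1−q)^n)) tends to 1 as q → 0, which yields that the price of anarchy of Bernoulli congestion games with a fixed number n of players tends to 1 as the maximum participation probability tends to 0.) -/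
open Finset

/-- Keeping only the `j = 0` term bounds the adjusted cost from below. -/
lemma le_adjCost_succ {c : ℕ → ℝ} (hc : ∀ k, 0 ≤ c k) {q : ℝ} (hq0 : 0 ≤ q) (hq1 : q ≤ 1)
    (x : ℕ) : q * ((1 - q) ^ x * c 1) ≤ adjCost c q (x + 1) := by
  have hp : 0 ≤ 1 - q := sub_nonneg.2 hq1
  unfold adjCost
  refine mul_le_mul_of_nonneg_left ?_ hq0
  rw [sum_range_succ']
  have : 0 ≤ ∑ j ∈ range x, ((x + 1 - 1).choose (j + 1) : ℝ) * q ^ (j + 1) *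
      (1 - q) ^ (x + 1 - 1 - (j + 1)) * c (1 + (j + 1)) :=
    sum_nonneg fun j _ => mul_nonneg (by positivity) (hc _)
  simpa using this

/-- If all costs up to load `x + 1` are at most `σ * c 1`, the adjusted cost is at most the one
in which every load above `1` costs exactly `σ * c 1`. -/
lemma adjCost_succ_le {c : ℕ → ℝ} {σ q : ℝ} (hq0 : 0 ≤ q) (hq1 : q ≤ 1) (x : ℕ)
    (hgrowth : ∀ k, 1 ≤ k → k ≤ x + 1 → c k ≤ σ * c 1) :
    adjCost c q (x + 1) ≤ q * ((1 - q) ^ x * c 1 + (1 - (1 - q) ^ x) * (σ * c 1)) := by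
  have hp : 0 ≤ 1 - q := sub_nonneg.2 hq1
  have htotal : ∑ j ∈ range (x + 1), (x.choose j : ℝ) * q ^ j * (1 - q) ^ (x - j) = 1 := by
    have h := add_pow q (1 - q) x
    rw [add_sub_cancel, one_pow] at h
    exact (sum_congr rfl fun j _ => by ring).trans h.symm
  rw [sum_range_succ'] at htotal
  simp only [Nat.choose_zero_right, Nat.cast_one, pow_zero, one_mul, Nat.sub_zero] at htotal
  unfold adjCost
  refine mul_le_mul_of_nonneg_left ?_ hq0
  rw [sum_range_succ', ← eq_sub_of_add_eq htotal, sum_mul, add_comm]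
  simp only [Nat.choose_zero_right, Nat.cast_one, pow_zero, one_mul, Nat.sub_zero,
    Nat.add_sub_cancel, add_zero]
  gcongr with j hj
  have := mem_range.1 hj
  exact hgrowth _ (by omega) (by omega)

/-- Let `c : ℕ → ℝ` be nonnegative, `n ≥ 1`, `σ ≥ 1` with `c(k) ≤ σ·c(1)` for
all `1 ≤ k ≤ n`, and `q ∈ (0,1)`.  Then for `1 ≤ k ≤ n` and `0 ≤ m ≤ n − 1`,
`c^q(m+1) ≤ (1−q)^{−n}·(1 + σ·(1 − (1−q)^n))·c^q(k)`. -/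
theorem adjCost_ratio_bound (c : ℕ → ℝ) (hc : ∀ k, 0 ≤ c k)
    (n : ℕ) (hn : 1 ≤ n) (σ : ℝ) (hσ : 1 ≤ σ)
    (hgrowth : ∀ k : ℕ, 1 ≤ k → k ≤ n → c k ≤ σ * c 1)
    (q : ℝ) (hq0 : 0 < q) (hq1 : q < 1)
    (k m : ℕ) (hk1 : 1 ≤ k) (hkn : k ≤ n) (hm : m ≤ n - 1) :
    adjCost c q (m + 1)
      ≤ ((1 - q) ^ n)⁻¹ * (1 + σ * (1 - (1 - q) ^ n)) * adjCost c q k := by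
  obtain ⟨x, rfl⟩ : ∃ x, k = x + 1 := ⟨k - 1, by omega⟩
  have hp : 0 < 1 - q := sub_pos.2 hq1
  have hp1 : 1 - q ≤ 1 := by linarith
  have hpn : (1 - q) ^ n ≤ 1 := pow_le_one₀ hp.le hp1
  have hc1 := hc 1
  have hfactor : 0 ≤ 1 + σ * (1 - (1 - q) ^ n) :=
    add_nonneg zero_le_one (mul_nonneg (by linarith) (sub_nonneg.2 hpn))
  have hupper : adjCost c q (m + 1) ≤ (1 + σ * (1 - (1 - q) ^ n)) * (q * c 1) := by
    have hpm : (1 - q) ^ m ≤ 1 := pow_le_one₀ hp.le hp1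
    have hnm : (1 - q) ^ n ≤ (1 - q) ^ m := pow_le_pow_of_le_one hp.le hp1 (by omega)
    calc adjCost c q (m + 1)
        ≤ q * ((1 - q) ^ m * c 1 + (1 - (1 - q) ^ m) * (σ * c 1)) :=
          adjCost_succ_le hq0.le hq1.le m fun k h1 h2 => hgrowth k h1 (by omega)
      _ ≤ q * (1 * c 1 + (1 - (1 - q) ^ n) * (σ * c 1)) := by gcongr
      _ = (1 + σ * (1 - (1 - q) ^ n)) * (q * c 1) := by ring
  have hlower : q * c 1 ≤ ((1 - q) ^ n)⁻¹ * adjCost c q (x + 1) := by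
    rw [le_inv_mul_iff₀ (pow_pos hp n)]
    calc (1 - q) ^ n * (q * c 1) = q * ((1 - q) ^ n * c 1) := by ring
      _ ≤ q * ((1 - q) ^ x * c 1) := by
          have : (1 - q) ^ n ≤ (1 - q) ^ x := pow_le_pow_of_le_one hp.le hp1 (by omega)
          gcongr
      _ ≤ adjCost c q (x + 1) := le_adjCost_succ hc hq0.le hq1.le x
  calc adjCost c q (m + 1) ≤ (1 + σ * (1 - (1 - q) ^ n)) * (q * c 1) := hupper
    _ ≤ (1 + σ * (1 - (1 - q) ^ n)) * (((1 - q) ^ n)⁻¹ * adjCost c q (x + 1)) := by gcongr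
    _ = ((1 - q) ^ n)⁻¹ * (1 + σ * (1 - (1 - q) ^ n)) * adjCost c q (x + 1) := by ring
end
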